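/- arXiv:2411.10012 — 2 statements merged into one kernel-verified Lean document; each statement's English description precedes it below -/
import Mathlib

section
/- Let m ≥ 2, n ≥ 1 be integers, d = m + n, and let p ∈ [4, ∞]. There is a constant C = C(m,n,p) > 0 such that for every λ ≥ 1, every dyadic integer N ≥ 1, and every g : ℝ^m×(1/λ)ℤⁿ → ℂ supported in {k : |k| ≤ 2N, and moreover |k| ≥ N/2 when N > 1}, one has the global-in-time Strichartz estimate ‖U_λ g‖_{L^p(ℝ^m×𝕋ⁿ_λ×ℝ)} ≤ C N^{d/2 − (d+2)/p} ‖g‖_{L²_λ}, where for p = ∞ the exponent is d/2 and the L^∞ norm is the essential supremum over ℝ^m×𝕋ⁿ_λ×ℝ. -/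
noncomputable section
open MeasureTheory
open scoped ENNReal NNReal Classical

/-- `|k|` for `k = (ζ, j/λ) ∈ ℝ^m × (1/λ)ℤⁿ`. -/
def freqNorm (lam : ℝ) {m n : ℕ} (ζ : Fin m → ℝ) (j : Fin n → ℤ) : ℝ :=
  Real.sqrt ((∑ i, (ζ i) ^ 2) + ∑ i, ((j i : ℝ) / lam) ^ 2)

/-- The free Schrödinger wave `(U_λ g)(t, x, y) = ∫ g(k) e^{i(z·k − t|k|²)} (dk)_λ`
on `ℝ^m × 𝕋ⁿ_λ`, where `g ζ j` stands for `g (ζ, j/λ)`. -/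
def waveU (lam : ℝ) {m n : ℕ} (g : (Fin m → ℝ) → (Fin n → ℤ) → ℂ)
    (t : ℝ) (x : Fin m → ℝ) (y : Fin n → ℝ) : ℂ :=
  ((1 / lam ^ n : ℝ) : ℂ) * ∑' j : Fin n → ℤ, ∫ ζ : Fin m → ℝ,
    g ζ j * Complex.exp (Complex.I *
      ((((∑ i, x i * ζ i) + ∑ i, y i * ((j i : ℝ) / lam))
        - t * ((∑ i, (ζ i) ^ 2) + ∑ i, ((j i : ℝ) / lam) ^ 2) : ℝ) : ℂ))

/-- Squared `L²_λ` norm of Fourier data on `ℝ^m × (1/λ)ℤⁿ`. -/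
def l2sq (lam : ℝ) {m n : ℕ} (g : (Fin m → ℝ) → (Fin n → ℤ) → ℂ) : ℝ≥0∞ :=
  ENNReal.ofReal (1 / lam ^ n) * ∑' j : Fin n → ℤ, ∫⁻ ζ : Fin m → ℝ, (‖g ζ j‖₊ : ℝ≥0∞) ^ 2

/-- `N` is a dyadic integer, i.e. `N ∈ 2^ℕ`. -/
def IsDyadic (N : ℝ) : Prop := ∃ a : ℕ, N = 2 ^ a

/-- `g` is supported in `{k : |k| ≤ 2N, and moreover |k| ≥ N/2 when N > 1}`. -/
def SuppIn (lam : ℝ) {m n : ℕ} (g : (Fin m → ℝ) → (Fin n → ℤ) → ℂ) (N : ℝ) : Prop :=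
  ∀ ζ j, g ζ j ≠ 0 → freqNorm lam ζ j ≤ 2 * N ∧ (1 < N → N / 2 ≤ freqNorm lam ζ j)

/-- One period box of the torus `𝕋ⁿ_λ`. -/
def torusBox (lam : ℝ) (n : ℕ) : Set (Fin n → ℝ) :=
  Set.Icc 0 (fun _ => 2 * Real.pi * lam)


lemma schur {Q K : Type*} [MeasurableSpace Q] [MeasurableSpace K] (ν : Measure Q)
    [IsFiniteMeasure ν] (μ : Measure K) [SFinite μ] (E : Q → K → ℂ)
    (hE : Measurable (Function.uncurry E)) (hE1 : ∀ q κ, ‖E q κ‖ = 1) (F : K → ℂ)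
    (hF : Integrable F μ) (S : Set K) (hS : MeasurableSet S) (hFS : ∀ κ, κ ∉ S → F κ = 0)
    (A : ℝ≥0∞)
    (hA : ∀ κ, ∫⁻ κ' in S, ‖∫ q, E q κ * (starRingEnd ℂ) (E q κ') ∂ν‖ₑ ∂μ ≤ A) :
    ∫⁻ q, ‖∫ κ, F κ * E q κ ∂μ‖ₑ ^ 2 ∂ν ≤ A * ∫⁻ κ, ‖F κ‖ₑ ^ 2 ∂μ := by
  set V : Q → ℂ := fun q => ∫ κ, F κ * E q κ ∂μ with hV
  set H : Q → K × K → ℂ := fun q z => (F z.1 * E q z.1) * (starRingEnd ℂ) (F z.2 * E q z.2) with hH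
  set ker : K × K → ℂ := fun z => ∫ q, E q z.1 * (starRingEnd ℂ) (E q z.2) ∂ν with hker
  have hE1m : Measurable (fun p : Q × (K × K) => E p.1 p.2.1) :=
    hE.comp (measurable_fst.prodMk (measurable_fst.comp measurable_snd))
  have hE2m : Measurable (fun p : Q × (K × K) => E p.1 p.2.2) :=
    hE.comp (measurable_fst.prodMk (measurable_snd.comp measurable_snd))
  have hconj : Measurable (fun z : ℂ => (starRingEnd ℂ) z) := Complex.continuous_conj.measurable
  have hHint : Integrable (Function.uncurry H) (ν.prod (μ.prod μ)) := by
    have hF2 : Integrable (fun z : K × K => F z.1 * (starRingEnd ℂ) (F z.2)) (μ.prod μ) :=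
      hF.mul_prod (g := fun x => (starRingEnd ℂ) (F x)) (by
        exact (Complex.conjCLE.toContinuousLinearMap).integrable_comp hF)
    have h1 : Integrable (fun p : Q × (K × K) => (1 : ℂ) * (F p.2.1 * (starRingEnd ℂ) (F p.2.2)))
        (ν.prod (μ.prod μ)) := (integrable_const (1 : ℂ)).mul_prod hF2
    refine (h1.bdd_mul (c := 1) (f := fun p : Q × (K × K) => E p.1 p.2.1 * (starRingEnd ℂ) (E p.1 p.2.2))
      (hE1m.mul (hconj.comp hE2m)).aestronglyMeasurable (by
        refine Filter.Eventually.of_forall fun p => ?_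
        simp [hE1])).congr ?_
    refine Filter.Eventually.of_forall fun p => ?_
    simp only [hH, Function.uncurry, map_mul]
    ring
  have hVV : ∀ q, ∫ z, H q z ∂(μ.prod μ) = ((‖V q‖ ^ 2 : ℝ) : ℂ) := by
    intro q
    simp only [hH]
    rw [integral_prod_mul (fun κ => F κ * E q κ) (fun κ => (starRingEnd ℂ) (F κ * E q κ)),
      integral_conj, Complex.mul_conj, Complex.normSq_eq_norm_sq]
  have hVint : Integrable (fun q => ((‖V q‖ ^ 2 : ℝ) : ℂ)) ν := by
    have := hHint.integral_prod_left
    simpa only [Function.uncurry, hVV] using this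
  have hkerm : StronglyMeasurable ker := by
    have : StronglyMeasurable (fun p : (K × K) × Q => E p.2 p.1.1 * (starRingEnd ℂ) (E p.2 p.1.2)) := by
      apply Measurable.stronglyMeasurable
      exact (hE1m.mul (hconj.comp hE2m)).comp measurable_swap
    exact this.integral_prod_right
  have hL : ∫⁻ q, ‖V q‖ₑ ^ 2 ∂ν = ‖∫ q, ((‖V q‖ ^ 2 : ℝ) : ℂ) ∂ν‖ₑ := by
    rw [integral_complex_ofReal]
    rw [show ‖((∫ q, ‖V q‖ ^ 2 ∂ν : ℝ) : ℂ)‖ₑ = ‖(∫ q, ‖V q‖ ^ 2 ∂ν : ℝ)‖ₑ by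
      rw [← ofReal_norm, ← ofReal_norm, Complex.norm_real]]
    rw [Real.enorm_eq_ofReal (integral_nonneg fun q => by positivity),
      ofReal_integral_eq_lintegral_ofReal (by exact hVint.re)
      (Filter.Eventually.of_forall fun q => by positivity)]
    refine lintegral_congr fun q => ?_
    rw [ENNReal.ofReal_pow (norm_nonneg _), ofReal_norm]
  rw [hL]
  have hsw : ∫ q, ((‖V q‖ ^ 2 : ℝ) : ℂ) ∂ν = ∫ z, (∫ q, H q z ∂ν) ∂(μ.prod μ) := by
    simp_rw [← hVV]
    exact integral_integral_swap hHint
  rw [hsw]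
  have hHk : ∀ z, ∫ q, H q z ∂ν = F z.1 * (starRingEnd ℂ) (F z.2) * ker z := by
    intro z
    simp only [hH, hker, ← integral_const_mul, map_mul]
    congr 1; ext q; ring
  simp_rw [hHk]
  refine (enorm_integral_le_lintegral_enorm _).trans ?_
  have hkF : AEMeasurable (fun κ => ‖F κ‖ₑ ^ 2) μ := hF.1.enorm.pow_const 2
  have hksymm : ∀ a b, ‖ker (a, b)‖ₑ = ‖ker (b, a)‖ₑ := by
    intro a b
    have : ker (b, a) = (starRingEnd ℂ) (ker (a, b)) := by
      simp only [hker, ← integral_conj, map_mul, Complex.conj_conj]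
      congr 1; ext q; ring
    rw [this, ← ofReal_norm, ← ofReal_norm, RCLike.norm_conj]
  have hkm : AEMeasurable (fun z => ‖ker z‖ₑ) (μ.prod μ) := hkerm.enorm.aemeasurable
  have hind : Measurable (S.indicator (fun _ => (1 : ℝ≥0∞))) := measurable_const.indicator hS
  set P : K × K → ℝ≥0∞ := fun z => ‖F z.1‖ₑ ^ 2 * (‖ker z‖ₑ * S.indicator (fun _ => 1) z.2) with hP
  set P' : K × K → ℝ≥0∞ := fun z => ‖F z.2‖ₑ ^ 2 * (‖ker z‖ₑ * S.indicator (fun _ => 1) z.1) with hP'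
  have hPm : AEMeasurable P (μ.prod μ) :=
    (hkF.comp_fst).mul (hkm.mul (hind.comp measurable_snd).aemeasurable)
  have hPb : ∫⁻ z, P z ∂(μ.prod μ) ≤ A * ∫⁻ κ, ‖F κ‖ₑ ^ 2 ∂μ := by
    rw [lintegral_prod _ hPm, ← lintegral_const_mul'' _ hkF]
    refine lintegral_mono fun κ => ?_
    have hk1 : Measurable fun y => ‖ker (κ, y)‖ₑ :=
      hkerm.enorm.comp measurable_prodMk_left
    simp only [hP]
    rw [lintegral_const_mul' _ _ (by simp), mul_comm]
    gcongr
    refine le_trans (le_of_eq ?_) (hA κ)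
    rw [← lintegral_indicator hS]
    refine lintegral_congr fun y => ?_
    by_cases h : y ∈ S <;> simp [h, hker]
  have hPP' : ∫⁻ z, P' z ∂(μ.prod μ) = ∫⁻ z, P z ∂(μ.prod μ) := by
    rw [← lintegral_prod_swap P]
    refine lintegral_congr fun z => ?_
    simp only [hP, hP', Prod.swap]
    rw [hksymm z.2 z.1]
  have h2 : 2 * ∫⁻ z, ‖F z.1 * (starRingEnd ℂ) (F z.2) * ker z‖ₑ ∂(μ.prod μ)
      ≤ 2 * (A * ∫⁻ κ, ‖F κ‖ₑ ^ 2 ∂μ) := by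
    calc _ = ∫⁻ z, 2 * ‖F z.1 * (starRingEnd ℂ) (F z.2) * ker z‖ₑ ∂(μ.prod μ) := by
          rw [lintegral_const_mul' _ _ (by simp)]
      _ ≤ ∫⁻ z, (P z + P' z) ∂(μ.prod μ) := by
          refine lintegral_mono fun z => ?_
          by_cases h1 : z.1 ∈ S
          · by_cases h2 : z.2 ∈ S
            · simp only [hP, hP', h1, h2, Set.indicator_of_mem, mul_one, enorm_mul]
              rw [← add_mul, ← mul_assoc]
              gcongr
              rw [show ‖(starRingEnd ℂ) (F z.2)‖ₑ = ‖F z.2‖ₑ by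
                rw [← ofReal_norm, ← ofReal_norm, RCLike.norm_conj]]
              simp only [← ofReal_norm]
              rw [← ENNReal.ofReal_mul (by positivity), ← ENNReal.ofReal_pow (by positivity),
                ← ENNReal.ofReal_pow (by positivity), ← ENNReal.ofReal_add (by positivity) (by positivity),
                show (2 : ℝ≥0∞) = ENNReal.ofReal 2 by simp, ← ENNReal.ofReal_mul (by positivity)]
              apply ENNReal.ofReal_le_ofReal
              nlinarith [sq_nonneg (‖F z.1‖ - ‖F z.2‖)]
            · simp [hFS _ h2]
          · simp [hFS _ h1]
      _ = (∫⁻ z, P z ∂(μ.prod μ)) + ∫⁻ z, P' z ∂(μ.prod μ) := lintegral_add_left' hPm _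
      _ ≤ _ := by rw [hPP', two_mul]; gcongr
  exact (ENNReal.mul_le_mul_iff_right (by simp) (by simp)).1 h2
lemma lintegral_radial {E : Type*} [NormedAddCommGroup E] [NormedSpace ℝ E] [MeasurableSpace E]
    [Nontrivial E] (μ : Measure E) [FiniteDimensional ℝ E] [BorelSpace E] [μ.IsAddHaarMeasure]
    (f : ℝ → ℝ≥0∞) (hf : Measurable f) :
    ∫⁻ x, f ‖x‖ ∂μ = μ.toSphere Set.univ *
      ∫⁻ y in Set.Ioi (0 : ℝ), ENNReal.ofReal (y ^ (Module.finrank ℝ E - 1)) * f y :=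
  calc
    ∫⁻ x, f (‖x‖) ∂μ = ∫⁻ x : ({(0)}ᶜ : Set E), f (‖x.1‖) ∂(μ.comap (↑)) := by
      rw [lintegral_subtype_comap (measurableSet_singleton _).compl (fun x ↦ f (‖x‖)),
        restrict_compl_singleton]
    _ = ∫⁻ x, f x.2 ∂μ.toSphere.prod (.volumeIoiPow (Module.finrank ℝ E - 1)) := by
      have := μ.measurePreserving_homeomorphUnitSphereProd.lintegral_comp
        (f := fun z => f (z.2 : ℝ)) (by fun_prop)
      simpa using this
    _ = μ.toSphere Set.univ * ∫⁻ x : Set.Ioi (0 : ℝ), f x ∂.volumeIoiPow (Module.finrank ℝ E - 1) := by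
      rw [lintegral_prod _ (by fun_prop)]
      simp [mul_comm]
    _ = _ := by
      simp only [Measure.volumeIoiPow]
      rw [lintegral_withDensity_eq_lintegral_mul _ (by fun_prop) (by fun_prop)]
      congr 1
      exact lintegral_subtype_comap measurableSet_Ioi
        (fun y => ENNReal.ofReal (y ^ (Module.finrank ℝ E - 1)) * f y)

lemma radial_bound (m : ℕ) (hm : 2 ≤ m) : ∃ C : ℝ, 0 < C ∧ ∀ (R : ℝ), 0 < R →
    ∀ h : ℝ → ℝ≥0∞, Measurable h →
    ∫⁻ b : Fin m → ℝ in {b | ∑ i, b i ^ 2 ≤ R ^ 2}, h (2 * ∑ i, b i ^ 2)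
      ≤ ENNReal.ofReal (C * R ^ (m - 2)) * ∫⁻ s, h s := by
  have : Nonempty (Fin m) := ⟨⟨0, by omega⟩⟩
  set T : ℝ≥0∞ := (volume : Measure (EuclideanSpace ℝ (Fin m))).toSphere Set.univ with hT
  have hTfin : T ≠ ⊤ := measure_ne_top _ _
  refine ⟨T.toReal + 1, by positivity, fun R hR h hh => ?_⟩
  have hms : MeasurableSet {b : Fin m → ℝ | ∑ i, b i ^ 2 ≤ R ^ 2} :=
    measurableSet_le (by fun_prop) (by fun_prop)
  set f : ℝ → ℝ≥0∞ := (Set.Iic R).indicator (fun ρ => h (2 * ρ ^ 2)) with hf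
  have hfm : Measurable f := Measurable.indicator (by fun_prop) measurableSet_Iic
  have h1 : ∫⁻ b : Fin m → ℝ in {b | ∑ i, b i ^ 2 ≤ R ^ 2}, h (2 * ∑ i, b i ^ 2)
      = ∫⁻ x : EuclideanSpace ℝ (Fin m), f ‖x‖ := by
    rw [← lintegral_indicator hms]
    rw [← (PiLp.volume_preserving_toLp (Fin m)).lintegral_comp (f := fun x => f ‖x‖) (by fun_prop)]
    refine lintegral_congr fun b => ?_
    have hn : ‖(WithLp.toLp 2 b : EuclideanSpace ℝ (Fin m))‖ ^ 2 = ∑ i, b i ^ 2 := by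
      rw [EuclideanSpace.norm_sq_eq]; simp
    simp only [hf, Set.indicator, Set.mem_ofPred_eq, Set.mem_Iic, ← hn]
    congr 1
    rw [eq_iff_iff, sq_le_sq₀ (norm_nonneg _) hR.le]
  rw [h1, lintegral_radial _ f hfm, finrank_euclideanSpace_fin]
  have h2 : ∫⁻ y in Set.Ioi (0 : ℝ), ENNReal.ofReal (y ^ (m - 1)) * f y
      ≤ ENNReal.ofReal (R ^ (m - 2)) * ∫⁻ y in Set.Ioi (0 : ℝ), ENNReal.ofReal |4 * y| * h (2 * y ^ 2) := by
    rw [← lintegral_const_mul' _ _ (by simp)]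
    refine setLIntegral_mono' measurableSet_Ioi fun y hy => ?_
    have hy : 0 < y := hy
    by_cases hyR : y ≤ R
    · simp only [hf, Set.indicator, Set.mem_Iic, hyR, if_true]
      rw [← mul_assoc, ← ENNReal.ofReal_mul (by positivity)]
      gcongr
      rw [abs_of_pos (by positivity)]
      obtain ⟨k, rfl⟩ : ∃ k, m = k + 2 := ⟨m - 2, by omega⟩
      simp only [Nat.add_sub_cancel]
      rw [show k + 2 - 1 = k + 1 by omega, pow_succ]
      have : y ^ k ≤ R ^ k := by gcongr
      have : 0 ≤ R ^ k := by positivity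
      nlinarith
    · simp [hf, hyR]
  have h3 : ∫⁻ y in Set.Ioi (0 : ℝ), ENNReal.ofReal |4 * y| * h (2 * y ^ 2) ≤ ∫⁻ s, h s := by
    rw [← lintegral_image_eq_lintegral_abs_deriv_mul (f := fun y => 2 * y ^ 2) (f' := fun y => 4 * y) measurableSet_Ioi
      (fun x _ => by
        have h0 : HasDerivAt (fun y : ℝ => 2 * y ^ 2) (2 * (((2 : ℕ) : ℝ) * x ^ (2 - 1))) x :=
          (hasDerivAt_pow 2 x).const_mul (2 : ℝ)
        have h00 : (2 * (((2 : ℕ) : ℝ) * x ^ (2 - 1))) = 4 * x := by norm_num; ring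
        rw [h00] at h0
        exact h0.hasDerivWithinAt) ?_ h]
    · exact setLIntegral_le_lintegral _ _
    · intro a ha b hb hab
      have ha : 0 < a := ha
      have hb : 0 < b := hb
      have : a ^ 2 = b ^ 2 := by simpa using hab
      exact (pow_left_inj₀ ha.le hb.le (by norm_num)).1 this
  calc _ ≤ T * (ENNReal.ofReal (R ^ (m - 2)) * ∫⁻ s, h s) := by gcongr; exact h2.trans (by gcongr)
    _ ≤ _ := by
      rw [← mul_assoc, ENNReal.ofReal_mul (by positivity)]
      gcongr
      rw [← ENNReal.ofReal_toReal hTfin]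
      apply ENNReal.ofReal_le_ofReal
      simp
def gam (ε s : ℝ) : ℝ := Real.sqrt (Real.pi / ε) * Real.exp (-(1 / (4 * ε)) * s ^ 2)

lemma gam_nonneg (ε s : ℝ) : 0 ≤ gam ε s := by unfold gam; positivity

lemma gam_neg (ε s : ℝ) : gam ε (-s) = gam ε s := by simp [gam]

lemma gam_meas (ε : ℝ) : Measurable (gam ε) := by unfold gam; fun_prop

lemma gam_ft {ε : ℝ} (hε : 0 < ε) (a : ℝ) :
    ∫ t : ℝ, ((Real.exp (-ε * t ^ 2) : ℝ) : ℂ) * Complex.exp (Complex.I * ((t * a : ℝ) : ℂ))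
      = (gam ε a : ℂ) := by
  have := fourierIntegral_gaussian (b := (ε : ℂ)) (by simpa using hε) (a : ℂ)
  rw [gam, Real.sqrt_eq_rpow]
  push_cast
  rw [Complex.ofReal_cpow (by positivity)]
  push_cast
  convert this using 2
  · ext t
    rw [mul_comm]
    congr 2
    ring
  · congr 1
    field_simp

lemma gam_integrable {ε : ℝ} (hε : 0 < ε) : Integrable (gam ε) :=
  (integrable_exp_neg_mul_sq (b := 1 / (4 * ε)) (by positivity)).const_mul _

lemma integral_gam {ε : ℝ} (hε : 0 < ε) : ∫ s, gam ε s = 2 * Real.pi := by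
  simp only [gam]
  rw [integral_const_mul, integral_gaussian, ← Real.sqrt_mul (by positivity)]
  rw [show Real.pi / ε * (Real.pi / (1 / (4 * ε))) = (2 * Real.pi) ^ 2 by field_simp; ring]
  exact Real.sqrt_sq (by positivity)

lemma lintegral_gam {ε : ℝ} (hε : 0 < ε) : ∫⁻ s, ENNReal.ofReal (gam ε s) = ENNReal.ofReal (2 * Real.pi) := by
  rw [← integral_gam hε, ofReal_integral_eq_lintegral_ofReal (gam_integrable hε)
    (Filter.Eventually.of_forall (gam_nonneg ε))]

lemma lintegral_gam_pi {ε : ℝ} (hε : 0 < ε) (m : ℕ) :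
    ∫⁻ ξ : Fin m → ℝ, ENNReal.ofReal (∏ i, gam ε (ξ i)) = ENNReal.ofReal ((2 * Real.pi) ^ m) := by
  rw [← integral_gam hε, ← ofReal_integral_eq_lintegral_ofReal]
  · rw [integral_fintype_prod_volume_eq_pow (gam ε)]; simp
  · exact Integrable.fintype_prod (f := fun _ => gam ε) fun _ => gam_integrable hε
  · exact Filter.Eventually.of_forall fun ξ => Finset.prod_nonneg fun i _ => gam_nonneg ε _

def phE {m : ℕ} (q : ℝ × (Fin m → ℝ)) (ζ : Fin m → ℝ) : ℂ :=
  Complex.exp (Complex.I * (((∑ i, q.2 i * ζ i) - q.1 * ∑ i, ζ i ^ 2 : ℝ) : ℂ))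

lemma phE_norm {m : ℕ} (q : ℝ × (Fin m → ℝ)) (ζ : Fin m → ℝ) : ‖phE q ζ‖ = 1 := by
  rw [phE, mul_comm, Complex.norm_exp_ofReal_mul_I]

lemma phE_cont {m : ℕ} : Continuous (fun z : (ℝ × (Fin m → ℝ)) × (Fin m → ℝ) => phE z.1 z.2) := by
  unfold phE; fun_prop

lemma phE_meas {m : ℕ} : Measurable (fun z : (ℝ × (Fin m → ℝ)) × (Fin m → ℝ) => phE z.1 z.2) :=
  phE_cont.measurable

def gw {m : ℕ} (ε : ℝ) (q : ℝ × (Fin m → ℝ)) : ℝ :=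
  Real.exp (-ε * q.1 ^ 2) * ∏ i, Real.exp (-ε * q.2 i ^ 2)

lemma gw_nonneg {m : ℕ} (ε : ℝ) (q : ℝ × (Fin m → ℝ)) : 0 ≤ gw ε q := by
  unfold gw; positivity

lemma gw_meas {m : ℕ} (ε : ℝ) : Measurable (gw (m := m) ε) := by unfold gw; fun_prop

lemma gw_integrable {m : ℕ} {ε : ℝ} (hε : 0 < ε) : Integrable (gw (m := m) ε) := by
  have h1 := integrable_exp_neg_mul_sq hε
  have h2 : Integrable (fun x : Fin m → ℝ => ∏ i, Real.exp (-ε * x i ^ 2)) :=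
    Integrable.fintype_prod (f := fun _ t => Real.exp (-ε * t ^ 2)) fun _ => h1
  exact h1.mul_prod h2

def nuE (m : ℕ) (ε : ℝ) : Measure (ℝ × (Fin m → ℝ)) :=
  (volume : Measure (ℝ × (Fin m → ℝ))).withDensity (fun q => ENNReal.ofReal (gw ε q))

lemma nuE_finite {m : ℕ} {ε : ℝ} (hε : 0 < ε) : IsFiniteMeasure (nuE m ε) :=
  isFiniteMeasure_withDensity_ofReal (gw_integrable hε).2

def pairE {m : ℕ} (q : ℝ × (Fin m → ℝ)) (κ : (Fin m → ℝ) × (Fin m → ℝ)) : ℂ :=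
  phE q κ.1 * phE q κ.2

lemma kernel_eq {m : ℕ} {ε : ℝ} (hε : 0 < ε) (κ κ' : (Fin m → ℝ) × (Fin m → ℝ)) :
    ∫ q, pairE q κ * (starRingEnd ℂ) (pairE q κ') ∂(nuE m ε)
      = ((gam ε ((∑ i, κ.1 i ^ 2) + (∑ i, κ.2 i ^ 2) - ((∑ i, κ'.1 i ^ 2) + (∑ i, κ'.2 i ^ 2))) *
        ∏ i, gam ε (κ.1 i + κ.2 i - (κ'.1 i + κ'.2 i)) : ℝ) : ℂ) := by
  set τ := (∑ i, κ.1 i ^ 2) + (∑ i, κ.2 i ^ 2) - ((∑ i, κ'.1 i ^ 2) + (∑ i, κ'.2 i ^ 2)) with hτ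
  rw [nuE, integral_withDensity_eq_integral_toReal_smul (by have := gw_meas (m := m) ε; fun_prop)
    (by simp)]
  have h1 : ∀ q : ℝ × (Fin m → ℝ), (ENNReal.ofReal (gw ε q)).toReal •
      (pairE q κ * (starRingEnd ℂ) (pairE q κ')) =
      (((Real.exp (-ε * q.1 ^ 2) : ℝ) : ℂ) * Complex.exp (Complex.I * ((q.1 * (-τ) : ℝ) : ℂ))) *
      ∏ i, (((Real.exp (-ε * q.2 i ^ 2) : ℝ) : ℂ) *
        Complex.exp (Complex.I * ((q.2 i * (κ.1 i + κ.2 i - (κ'.1 i + κ'.2 i)) : ℝ) : ℂ))) := by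
    intro q
    rw [ENNReal.toReal_ofReal (gw_nonneg ε q), Finset.prod_mul_distrib, ← Complex.exp_sum, gw,
      Complex.real_smul]
    push_cast
    have : pairE q κ * (starRingEnd ℂ) (pairE q κ') =
      Complex.exp (Complex.I * ((q.1 * (-τ) : ℝ) : ℂ)) * Complex.exp (∑ i,
        Complex.I * ((q.2 i * (κ.1 i + κ.2 i - (κ'.1 i + κ'.2 i)) : ℝ) : ℂ)) := by
      simp only [pairE, phE, map_mul, ← Complex.exp_conj, Complex.conj_I, Complex.conj_ofReal]
      simp only [← Complex.exp_add, ← Finset.mul_sum]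
      congr 1
      rw [← Complex.ofReal_sum]
      have : (∑ i, q.2 i * (κ.1 i + κ.2 i - (κ'.1 i + κ'.2 i))) =
        ∑ i, q.2 i * κ.1 i + ∑ i, q.2 i * κ.2 i - (∑ i, q.2 i * κ'.1 i + ∑ i, q.2 i * κ'.2 i) := by
        simp only [← Finset.sum_add_distrib, ← Finset.sum_sub_distrib]
        congr 1; ext i; ring
      rw [this, hτ]
      push_cast
      ring
    rw [this]
    push_cast
    ring
  simp_rw [h1]
  rw [Measure.volume_eq_prod, integral_prod_mul (fun t : ℝ => ((Real.exp (-ε * t ^ 2) : ℝ) : ℂ) *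
    Complex.exp (Complex.I * ((t * (-τ) : ℝ) : ℂ))) (fun x : Fin m → ℝ =>
    ∏ i, (((Real.exp (-ε * x i ^ 2) : ℝ) : ℂ) *
        Complex.exp (Complex.I * ((x i * (κ.1 i + κ.2 i - (κ'.1 i + κ'.2 i)) : ℝ) : ℂ)))),
    gam_ft hε, gam_neg, integral_fintype_prod_volume_eq_prod (f := fun i (t : ℝ) =>
      ((Real.exp (-ε * t ^ 2) : ℝ) : ℂ) *
        Complex.exp (Complex.I * ((t * (κ.1 i + κ.2 i - (κ'.1 i + κ'.2 i)) : ℝ) : ℂ)))]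
  simp_rw [gam_ft hε]
  push_cast
  rfl

lemma kernel_bound (m : ℕ) (hm : 2 ≤ m) : ∃ C : ℝ, 0 < C ∧ ∀ (R : ℝ), 0 < R → ∀ ε : ℝ, 0 < ε →
    ∀ κ : (Fin m → ℝ) × (Fin m → ℝ),
    ∫⁻ κ' in {ζ : Fin m → ℝ | ∑ i, ζ i ^ 2 ≤ R ^ 2} ×ˢ {ζ : Fin m → ℝ | ∑ i, ζ i ^ 2 ≤ R ^ 2},
      ‖∫ q, pairE q κ * (starRingEnd ℂ) (pairE q κ') ∂(nuE m ε)‖ₑ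
      ≤ ENNReal.ofReal (C * R ^ (m - 2)) := by
  obtain ⟨C, hC, hCb⟩ := radial_bound m hm
  refine ⟨C * (2 * Real.pi) * (2 * Real.pi) ^ m, by positivity, fun R hR ε hε κ => ?_⟩
  set S := {ζ : Fin m → ℝ | ∑ i, ζ i ^ 2 ≤ R ^ 2} with hS
  have hSm : MeasurableSet S := measurableSet_le (by fun_prop) (by fun_prop)
  set τ := (∑ i, κ.1 i ^ 2) + (∑ i, κ.2 i ^ 2) with hτ
  have hgm := gam_meas ε
  -- integrand after extending
  set G : (Fin m → ℝ) → (Fin m → ℝ) → ℝ≥0∞ := fun a c =>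
    S.indicator (fun _ => 1) ((1 / 2 : ℝ) • (a - c)) *
      (ENNReal.ofReal (gam ε (τ - ((∑ i, a i ^ 2) + (∑ i, c i ^ 2)))) *
        ENNReal.ofReal (∏ i, gam ε (κ.1 i + κ.2 i - (a i + c i)))) with hG
  have hind : Measurable (S.indicator (fun _ => (1 : ℝ≥0∞))) := measurable_const.indicator hSm
  have hGm : Measurable (Function.uncurry G) := by
    simp only [hG, Function.uncurry_def]
    fun_prop
  calc _ ≤ ∫⁻ κ' : (Fin m → ℝ) × (Fin m → ℝ), G κ'.1 κ'.2 := by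
        rw [← lintegral_indicator (hSm.prod hSm)]
        refine lintegral_mono fun κ' => ?_
        refine Set.indicator_le' (f := fun κ' => ‖∫ q, pairE q κ * (starRingEnd ℂ) (pairE q κ') ∂(nuE m ε)‖ₑ)
          (g := fun κ' => G κ'.1 κ'.2) ?_ ?_ κ'
        · intro κ' hκ'
          have hmem : (1 / 2 : ℝ) • (κ'.1 - κ'.2) ∈ S := by
            have h1 : ∑ i, κ'.1 i ^ 2 ≤ R ^ 2 := hκ'.1
            have h2 : ∑ i, κ'.2 i ^ 2 ≤ R ^ 2 := hκ'.2
            show ∑ i, ((1 / 2 : ℝ) * (κ'.1 i - κ'.2 i)) ^ 2 ≤ R ^ 2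
            calc _ ≤ ∑ i, (κ'.1 i ^ 2 + κ'.2 i ^ 2) / 2 := by
                  refine Finset.sum_le_sum fun i _ => ?_
                  nlinarith [sq_nonneg (κ'.1 i + κ'.2 i)]
              _ = (∑ i, κ'.1 i ^ 2 + ∑ i, κ'.2 i ^ 2) / 2 := by
                  rw [← Finset.sum_add_distrib, Finset.sum_div]
              _ ≤ _ := by linarith
          simp only [hG, Set.indicator_of_mem hmem, one_mul]
          rw [kernel_eq hε, ← ENNReal.ofReal_mul (gam_nonneg _ _), ← ofReal_norm, Complex.norm_real,
            Real.norm_of_nonneg (mul_nonneg (gam_nonneg _ _) (Finset.prod_nonneg fun i _ => gam_nonneg _ _))]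
        · intro κ' _; exact zero_le
    _ = ∫⁻ a : Fin m → ℝ, ∫⁻ c : Fin m → ℝ, G a c := by
        rw [Measure.volume_eq_prod]
        exact lintegral_prod (fun z => G z.1 z.2) hGm.aemeasurable
    _ = ∫⁻ a : Fin m → ℝ, ∫⁻ η : Fin m → ℝ, G a (η - a) := by
        refine lintegral_congr fun a => ?_
        exact (lintegral_sub_right_eq_self (G a) a).symm
    _ = ∫⁻ η : Fin m → ℝ, ∫⁻ a : Fin m → ℝ, G a (η - a) := by
        rw [lintegral_lintegral_swap]
        refine Measurable.aemeasurable ?_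
        exact hGm.comp (f := fun z : (Fin m → ℝ) × (Fin m → ℝ) => (z.1, z.2 - z.1)) (by fun_prop)
    _ = ∫⁻ η : Fin m → ℝ, ∫⁻ b : Fin m → ℝ, G (b + (1 / 2 : ℝ) • η) (η - (b + (1 / 2 : ℝ) • η)) := by
        refine lintegral_congr fun η => ?_
        exact (lintegral_add_right_eq_self (fun a => G a (η - a)) ((1 / 2 : ℝ) • η)).symm
    _ ≤ ∫⁻ η : Fin m → ℝ, ENNReal.ofReal (C * R ^ (m - 2) * (2 * Real.pi)) *
          ENNReal.ofReal (∏ i, gam ε (κ.1 i + κ.2 i - η i)) := by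
        refine lintegral_mono fun η => ?_
        set σ := τ - (1 / 2) * ∑ i, η i ^ 2 with hσ
        have h1 : ∀ b : Fin m → ℝ, G (b + (1 / 2 : ℝ) • η) (η - (b + (1 / 2 : ℝ) • η)) =
          S.indicator (fun b => ENNReal.ofReal (gam ε (σ - 2 * ∑ i, b i ^ 2))) b *
            ENNReal.ofReal (∏ i, gam ε (κ.1 i + κ.2 i - η i)) := by
          intro b
          have e1 : (1 / 2 : ℝ) • ((b + (1 / 2 : ℝ) • η) - (η - (b + (1 / 2 : ℝ) • η))) = b := by
            ext i; simp; ring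
          have e2 : τ - ((∑ i, (b + (1 / 2 : ℝ) • η) i ^ 2) + (∑ i, (η - (b + (1 / 2 : ℝ) • η)) i ^ 2))
              = σ - 2 * ∑ i, b i ^ 2 := by
            rw [hσ, Finset.mul_sum, Finset.mul_sum, sub_sub, ← Finset.sum_add_distrib,
              ← Finset.sum_add_distrib]
            congr 2; ext i; simp; ring
          have e3 : ∀ i, (b + (1 / 2 : ℝ) • η) i + (η - (b + (1 / 2 : ℝ) • η)) i = η i := by
            intro i; simp
          simp only [hG, e1, e2, e3]
          by_cases hb : b ∈ S <;> simp [hb]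
        simp_rw [h1]
        rw [lintegral_mul_const' _ _ (by simp)]
        gcongr
        rw [lintegral_indicator hSm]
        refine (hCb R hR (fun s => ENNReal.ofReal (gam ε (σ - s))) (by fun_prop)).trans ?_
        rw [lintegral_sub_left_eq_self (fun s => ENNReal.ofReal (gam ε s)) σ, lintegral_gam hε,
          ← ENNReal.ofReal_mul (by positivity)]
    _ = _ := by
        rw [lintegral_const_mul' _ _ (by simp)]
        have := lintegral_sub_left_eq_self (μ := (volume : Measure (Fin m → ℝ)))
          (fun ξ => ENNReal.ofReal (∏ i, gam ε (ξ i))) (κ.1 + κ.2)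
        simp only [Pi.sub_apply, Pi.add_apply] at this
        rw [this, lintegral_gam_pi hε, ← ENNReal.ofReal_mul (by positivity)]
        congr 1; ring

def vf {m : ℕ} (f : (Fin m → ℝ) → ℂ) (q : ℝ × (Fin m → ℝ)) : ℂ := ∫ ζ, f ζ * phE q ζ

lemma vf_meas {m : ℕ} {f : (Fin m → ℝ) → ℂ} (hf : Integrable f) : Continuous (vf f) := by
  unfold vf
  refine continuous_of_dominated (bound := fun ζ => ‖f ζ‖) ?_ ?_ hf.norm ?_
  · intro q
    exact hf.1.mul (phE_cont.comp (by fun_prop : Continuous fun ζ => (q, ζ))).aestronglyMeasurable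
  · intro q
    exact Filter.Eventually.of_forall fun ζ => by simp [phE_norm]
  · exact Filter.Eventually.of_forall fun ζ =>
      continuous_const.mul (phE_cont.comp (by fun_prop : Continuous fun q => (q, ζ)))

lemma pairE_meas {m : ℕ} : Measurable (Function.uncurry (pairE (m := m))) := by
  unfold pairE phE
  simp only [Function.uncurry_def]
  fun_prop

lemma L4R (m : ℕ) (hm : 2 ≤ m) : ∃ C : ℝ, 0 < C ∧ ∀ (R : ℝ), 0 < R → ∀ f : (Fin m → ℝ) → ℂ,
    Integrable f → (∀ ζ, f ζ ≠ 0 → ∑ i, ζ i ^ 2 ≤ R ^ 2) →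
    ∫⁻ q, ‖vf f q‖ₑ ^ 4 ≤ ENNReal.ofReal (C * R ^ (m - 2)) * (∫⁻ ζ, ‖f ζ‖ₑ ^ 2) ^ 2 := by
  obtain ⟨C, hC, hCb⟩ := kernel_bound m hm
  refine ⟨C, hC, fun R hR f hf hsupp => ?_⟩
  set S := {ζ : Fin m → ℝ | ∑ i, ζ i ^ 2 ≤ R ^ 2} with hS
  have hSm : MeasurableSet S := measurableSet_le (by fun_prop) (by fun_prop)
  have hvm : Measurable fun q => ‖vf f q‖ₑ ^ 4 := ((vf_meas hf).measurable.enorm).pow_const 4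
  have key : ∀ ε : ℝ, 0 < ε → ∫⁻ q, ENNReal.ofReal (gw ε q) * ‖vf f q‖ₑ ^ 4
      ≤ ENNReal.ofReal (C * R ^ (m - 2)) * (∫⁻ ζ, ‖f ζ‖ₑ ^ 2) ^ 2 := by
    intro ε hε
    have := nuE_finite (m := m) hε
    have hff : Integrable (fun κ : (Fin m → ℝ) × (Fin m → ℝ) => f κ.1 * f κ.2) := hf.mul_prod hf
    have h1 := schur (nuE m ε) (volume : Measure ((Fin m → ℝ) × (Fin m → ℝ))) pairE
      pairE_meas
      (fun q κ => by simp [pairE, phE_norm])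
      (fun κ => f κ.1 * f κ.2) hff (S ×ˢ S) (hSm.prod hSm)
      (by
        intro κ hκ
        by_contra h
        have h := mul_ne_zero_iff.1 h
        exact hκ ⟨hsupp _ h.1, hsupp _ h.2⟩)
      (ENNReal.ofReal (C * R ^ (m - 2))) (hCb R hR ε hε)
    have h2 : ∀ q, ∫ κ : (Fin m → ℝ) × (Fin m → ℝ), f κ.1 * f κ.2 * pairE q κ = vf f q ^ 2 := by
      intro q
      rw [vf, sq, ← integral_prod_mul, Measure.volume_eq_prod]
      congr 1; ext κ; simp only [pairE]; ring
    have h3 : ∫⁻ κ : (Fin m → ℝ) × (Fin m → ℝ), ‖f κ.1 * f κ.2‖ₑ ^ 2 = (∫⁻ ζ, ‖f ζ‖ₑ ^ 2) ^ 2 := by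
      rw [Measure.volume_eq_prod]
      simp_rw [enorm_mul, mul_pow]
      rw [lintegral_prod_mul (hf.1.enorm.pow_const 2) (hf.1.enorm.pow_const 2), sq]
    rw [h3] at h1
    simp_rw [h2] at h1
    rw [nuE, lintegral_withDensity_eq_lintegral_mul _ (gw_meas ε).ennreal_ofReal (by
      have := (vf_meas hf).measurable
      fun_prop)] at h1
    refine le_trans (le_of_eq ?_) h1
    refine lintegral_congr fun q => ?_
    simp only [Pi.mul_apply, enorm_pow, ← pow_mul]
  set e : ℕ → ℝ := fun k => 1 / ((k : ℝ) + 1) with he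
  have hlim : ∀ q, Filter.Tendsto (fun k => ENNReal.ofReal (gw (m := m) (e k) q) * ‖vf f q‖ₑ ^ 4) Filter.atTop
      (nhds (‖vf f q‖ₑ ^ 4)) := by
    intro q
    have h0 : Filter.Tendsto e Filter.atTop (nhds 0) := tendsto_one_div_add_atTop_nhds_zero_nat
    have h1 : Filter.Tendsto (fun k => gw (m := m) (e k) q) Filter.atTop (nhds 1) := by
      have hc : Continuous fun ε : ℝ => gw (m := m) ε q := by unfold gw; fun_prop
      have := (hc.tendsto 0).comp h0
      simpa [gw, Function.comp_def] using this
    have h2 := ENNReal.tendsto_ofReal h1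
    have h3 := ENNReal.Tendsto.mul_const (b := ‖vf f q‖ₑ ^ 4) h2 (Or.inl (by simp))
    simpa using h3
  calc ∫⁻ q, ‖vf f q‖ₑ ^ 4 = ∫⁻ q, Filter.liminf (fun k => ENNReal.ofReal (gw (m := m) (e k) q) * ‖vf f q‖ₑ ^ 4) Filter.atTop := by
        refine lintegral_congr fun q => (hlim q).liminf_eq.symm
    _ ≤ Filter.liminf (fun k => ∫⁻ q, ENNReal.ofReal (gw (m := m) (e k) q) * ‖vf f q‖ₑ ^ 4) Filter.atTop :=
        lintegral_liminf_le fun k => (gw_meas _).ennreal_ofReal.mul hvm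
    _ ≤ _ := by
        refine Filter.liminf_le_of_frequently_le' (Filter.Frequently.of_forall fun k => key _ ?_)
        simp only [he]; positivity

def chE {n : ℕ} (lam : ℝ) (y : Fin n → ℝ) (j : Fin n → ℤ) : ℂ :=
  Complex.exp (Complex.I * ((∑ i, y i * ((j i : ℝ) / lam) : ℝ) : ℂ))

lemma chE_norm {n : ℕ} (lam : ℝ) (y : Fin n → ℝ) (j : Fin n → ℤ) : ‖chE lam y j‖ = 1 := by
  rw [chE, mul_comm, Complex.norm_exp_ofReal_mul_I]

lemma chE_cont {n : ℕ} (lam : ℝ) (j : Fin n → ℤ) : Continuous (fun y => chE lam y j) := by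
  unfold chE; fun_prop

lemma restrict_torusBox (lam : ℝ) (n : ℕ) :
    (volume : Measure (Fin n → ℝ)).restrict (torusBox lam n) =
      Measure.pi (fun _ => (volume : Measure ℝ).restrict (Set.Icc 0 (2 * Real.pi * lam))) := by
  rw [torusBox, ← Set.pi_univ_Icc, volume_pi, Measure.restrict_pi_pi]
  rfl

instance (lam : ℝ) (n : ℕ) : IsFiniteMeasure ((volume : Measure (Fin n → ℝ)).restrict (torusBox lam n)) := by
  rw [restrict_torusBox]; infer_instance

lemma orth1 {lam : ℝ} (hl : 0 < lam) (k : ℤ) :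
    ∫ y in Set.Icc 0 (2 * Real.pi * lam), Complex.exp (Complex.I * ((y * ((k : ℝ) / lam) : ℝ) : ℂ))
      = if k = 0 then ((2 * Real.pi * lam : ℝ) : ℂ) else 0 := by
  have hpos : 0 ≤ 2 * Real.pi * lam := by positivity
  rw [integral_Icc_eq_integral_Ioc, ← intervalIntegral.integral_of_le hpos]
  by_cases hk : k = 0
  · simp [hk]
  · rw [if_neg hk]
    have hc : (Complex.I * ((k : ℂ) / lam)) ≠ 0 := by
      simp [hk, hl.ne']
    have := integral_exp_mul_complex (a := 0) (b := 2 * Real.pi * lam) hc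
    have h2 : ∀ y : ℝ, Complex.I * ((y * ((k : ℝ) / lam) : ℝ) : ℂ) = (Complex.I * ((k : ℂ) / lam)) * y := by
      intro y; push_cast; ring
    simp_rw [h2]
    rw [this]
    have h3 : Complex.I * ((k : ℂ) / lam) * ((2 * Real.pi * lam : ℝ) : ℂ) = k * (2 * Real.pi * Complex.I) := by
      have : (lam : ℂ) ≠ 0 := by exact_mod_cast hl.ne'
      push_cast; field_simp
    rw [h3, Complex.exp_int_mul_two_pi_mul_I]
    simp

lemma orthn {n : ℕ} {lam : ℝ} (hl : 0 < lam) (j l : Fin n → ℤ) :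
    ∫ y in torusBox lam n, chE lam y j * (starRingEnd ℂ) (chE lam y l)
      = if j = l then (((2 * Real.pi * lam) ^ n : ℝ) : ℂ) else 0 := by
  have h1 : ∀ y : Fin n → ℝ, chE lam y j * (starRingEnd ℂ) (chE lam y l) =
      ∏ i, Complex.exp (Complex.I * ((y i * (((j i - l i : ℤ) : ℝ) / lam) : ℝ) : ℂ)) := by
    intro y
    rw [← Complex.exp_sum]
    simp only [chE, ← Complex.exp_conj, map_mul, Complex.conj_I, Complex.conj_ofReal, ← Complex.exp_add]
    congr 1
    push_cast
    simp only [Finset.mul_sum, ← Finset.sum_add_distrib]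
    congr 1; ext i; ring
  simp_rw [h1]
  rw [restrict_torusBox, integral_fintype_prod_eq_prod (f := fun i (y : ℝ) =>
    Complex.exp (Complex.I * ((y * (((j i - l i : ℤ) : ℝ) / lam) : ℝ) : ℂ)))]
  simp_rw [orth1 hl]
  by_cases h : j = l
  · subst h; simp
  · rw [if_neg h]
    obtain ⟨i, hi⟩ := Function.ne_iff.1 h
    refine Finset.prod_eq_zero (Finset.mem_univ i) ?_
    rw [if_neg (sub_ne_zero.2 hi)]

lemma parseval {n : ℕ} {lam : ℝ} (hl : 0 < lam) (s : Finset (Fin n → ℤ)) (a : (Fin n → ℤ) → ℂ) :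
    ∫⁻ y in torusBox lam n, ‖∑ j ∈ s, a j * chE lam y j‖ₑ ^ 2
      = ENNReal.ofReal ((2 * Real.pi * lam) ^ n * ∑ j ∈ s, ‖a j‖ ^ 2) := by
  have hP : Continuous fun y : Fin n → ℝ => ∑ j ∈ s, a j * chE lam y j :=
    continuous_finsetSum _ fun j _ => continuous_const.mul (chE_cont lam j)
  have hb : ∀ (f : (Fin n → ℝ) → ℂ), Continuous f → IntegrableOn f (torusBox lam n) := by
    intro f hf
    exact hf.continuousOn.integrableOn_compact (by unfold torusBox; exact isCompact_Icc)
  have h0 : ∫⁻ y in torusBox lam n, ‖∑ j ∈ s, a j * chE lam y j‖ₑ ^ 2 =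
      ENNReal.ofReal (∫ y in torusBox lam n, ‖∑ j ∈ s, a j * chE lam y j‖ ^ 2) := by
    rw [ofReal_integral_eq_lintegral_ofReal]
    · refine lintegral_congr fun y => ?_
      rw [ENNReal.ofReal_pow (norm_nonneg _), ofReal_norm]
    · exact (hP.norm.pow 2).continuousOn.integrableOn_compact (by unfold torusBox; exact isCompact_Icc)
    · exact Filter.Eventually.of_forall fun y => by positivity
  rw [h0]
  congr 1
  apply Complex.ofReal_injective
  rw [← integral_complex_ofReal]
  have h1 : ∀ y : Fin n → ℝ, ((‖∑ j ∈ s, a j * chE lam y j‖ ^ 2 : ℝ) : ℂ) =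
      ∑ j ∈ s, ∑ l ∈ s, (a j * (starRingEnd ℂ) (a l)) * (chE lam y j * (starRingEnd ℂ) (chE lam y l)) := by
    intro y
    rw [← Complex.normSq_eq_norm_sq, ← Complex.mul_conj, map_sum, Finset.sum_mul_sum]
    refine Finset.sum_congr rfl fun j _ => Finset.sum_congr rfl fun l _ => ?_
    rw [map_mul]; ring
  have hc2 : ∀ j l : Fin n → ℤ, Continuous fun y => (a j * (starRingEnd ℂ) (a l)) *
      (chE lam y j * (starRingEnd ℂ) (chE lam y l)) := fun j l =>
    continuous_const.mul ((chE_cont lam j).mul (Complex.continuous_conj.comp (chE_cont lam l)))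
  simp_rw [h1]
  rw [integral_finsetSum _ fun j _ => hb _ (continuous_finsetSum _ fun l _ => hc2 j l)]
  simp_rw [integral_finsetSum s fun l _ => hb _ (hc2 _ l), integral_const_mul, orthn hl]
  push_cast
  rw [Finset.mul_sum]
  refine Finset.sum_congr rfl fun j hj => ?_
  rw [Finset.sum_eq_single j (fun l _ h => by simp [h.symm]) (fun h => absurd hj h)]
  rw [if_pos rfl, Complex.mul_conj, Complex.normSq_eq_norm_sq]
  push_cast; ring


lemma cs_lintegral {α : Type*} [MeasurableSpace α] (μ : Measure α) (f g : α → ℝ≥0∞)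
    (hf : AEMeasurable f μ) (hg : AEMeasurable g μ) :
    (∫⁻ a, f a * g a ∂μ) ^ 2 ≤ (∫⁻ a, f a ^ 2 ∂μ) * ∫⁻ a, g a ^ 2 ∂μ := by
  have h := ENNReal.lintegral_mul_le_Lp_mul_Lq μ (p := 2) (q := 2)
    (Real.HolderConjugate.two_two) hf hg
  simp only [Pi.mul_apply, ENNReal.rpow_two] at h
  calc _ ≤ ((∫⁻ a, f a ^ 2 ∂μ) ^ (1 / 2 : ℝ) * (∫⁻ a, g a ^ 2 ∂μ) ^ (1 / 2 : ℝ)) ^ 2 := by gcongr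
    _ = _ := by
      rw [mul_pow, ← ENNReal.rpow_two, ← ENNReal.rpow_two, ← ENNReal.rpow_mul, ← ENNReal.rpow_mul]
      norm_num

lemma sum_sq_lintegral {α ι : Type*} [MeasurableSpace α] (μ : Measure α) (s : Finset ι)
    (A : ι → α → ℝ≥0∞) (hA : ∀ i, AEMeasurable (A i) μ) (B : ℝ≥0∞) (c : ι → ℝ≥0∞)
    (h : ∀ i, ∫⁻ a, A i a ^ 2 ∂μ ≤ B * c i ^ 2) :
    ∫⁻ a, (∑ i ∈ s, A i a) ^ 2 ∂μ ≤ B * (∑ i ∈ s, c i) ^ 2 := by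
  have h2 : ∀ i j, ∫⁻ a, A i a * A j a ∂μ ≤ B * (c i * c j) := by
    intro i j
    have := (cs_lintegral μ _ _ (hA i) (hA j)).trans (mul_le_mul' (h i) (h j))
    rw [show B * c i ^ 2 * (B * c j ^ 2) = (B * (c i * c j)) ^ 2 by ring] at this
    exact (ENNReal.pow_le_pow_left_iff (by norm_num)).1 this
  have hm : ∀ i j, AEMeasurable (fun a => A i a * A j a) μ := fun i j => (hA i).mul (hA j)
  simp_rw [sq, Finset.sum_mul_sum]
  rw [lintegral_finsetSum' _ fun i _ => Finset.aemeasurable_fun_sum _ fun j _ => hm i j]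
  rw [Finset.mul_sum]
  refine Finset.sum_le_sum fun i _ => ?_
  rw [lintegral_finsetSum' _ fun j _ => hm i j, Finset.mul_sum]
  exact Finset.sum_le_sum fun j _ => h2 i j

lemma enorm_sum_sq_le {ι : Type*} (s : Finset ι) (a : ι → ℂ) :
    ‖∑ i ∈ s, a i‖ₑ ^ 2 ≤ (s.card : ℝ≥0∞) * ∑ i ∈ s, ‖a i‖ₑ ^ 2 := by
  have h : ‖∑ i ∈ s, a i‖ ^ 2 ≤ s.card * ∑ i ∈ s, ‖a i‖ ^ 2 :=
    (pow_le_pow_left₀ (norm_nonneg _) (norm_sum_le _ _) 2).trans sq_sum_le_card_mul_sum_sq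
  have h2 := ENNReal.ofReal_le_ofReal h
  rw [ENNReal.ofReal_mul (by positivity), ENNReal.ofReal_sum_of_nonneg (fun i _ => by positivity),
    ENNReal.ofReal_pow (norm_nonneg _), ofReal_norm] at h2
  simpa [ENNReal.ofReal_pow (norm_nonneg _), ofReal_norm] using h2

lemma interp {α : Type*} [MeasurableSpace α] (μ : Measure α) (u : α → ℂ) (p : ℝ≥0∞) (hp : 4 ≤ p)
    (hpt : p ≠ ⊤) (M B r : ℝ) (hM : 0 ≤ M) (hB : 0 ≤ B) (hr : 0 ≤ r)
    (h1 : ∀ q, ‖u q‖ₑ ≤ ENNReal.ofReal (M * r))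
    (h4 : ∫⁻ q, ‖u q‖ₑ ^ 4 ∂μ ≤ ENNReal.ofReal (B * r ^ 4)) :
    eLpNorm u p μ ≤ ENNReal.ofReal ((M ^ (p.toReal - 4) * B) ^ (1 / p.toReal) * r) := by
  have hp4 : 4 ≤ p.toReal := by
    have := ENNReal.toReal_mono hpt hp
    simpa using this
  have hp0 : p ≠ 0 := by
    rintro rfl; norm_num at hp
  rw [eLpNorm_eq_lintegral_rpow_enorm_toReal hp0 hpt]
  have h : ∫⁻ q, ‖u q‖ₑ ^ p.toReal ∂μ ≤ ENNReal.ofReal ((M * r) ^ (p.toReal - 4) * (B * r ^ 4)) := by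
    calc _ ≤ ∫⁻ q, ENNReal.ofReal ((M * r) ^ (p.toReal - 4)) * ‖u q‖ₑ ^ 4 ∂μ := by
          refine lintegral_mono fun q => ?_
          calc ‖u q‖ₑ ^ p.toReal = ‖u q‖ₑ ^ ((p.toReal - 4) + (4 : ℕ)) := by congr 1; push_cast; ring
            _ = ‖u q‖ₑ ^ (p.toReal - 4) * ‖u q‖ₑ ^ 4 := by
              rw [ENNReal.rpow_add_of_nonneg _ _ (by linarith) (by norm_num), ENNReal.rpow_natCast]
            _ ≤ _ := by
              gcongr
              rw [← ENNReal.ofReal_rpow_of_nonneg (by positivity) (by linarith)]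
              exact ENNReal.rpow_le_rpow (h1 q) (by linarith)
      _ ≤ _ := by
          rw [lintegral_const_mul' _ _ (by simp), ENNReal.ofReal_mul (by positivity)]
          gcongr
  refine (ENNReal.rpow_le_rpow h (by positivity)).trans ?_
  rw [ENNReal.ofReal_rpow_of_nonneg (by positivity) (by positivity)]
  apply ENNReal.ofReal_le_ofReal
  apply le_of_eq
  have e : (M * r) ^ (p.toReal - 4) * (B * r ^ 4) = (M ^ (p.toReal - 4) * B) * r ^ p.toReal := by
    rw [Real.mul_rpow hM hr]
    have : r ^ p.toReal = r ^ (p.toReal - 4) * r ^ 4 := by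
      rw [← Real.rpow_natCast r 4, ← Real.rpow_add_of_nonneg hr (by linarith) (by norm_num)]
      congr 1; push_cast; ring
    rw [this]; ring
  rw [e, Real.mul_rpow (by positivity) (by positivity), ← Real.rpow_mul hr,
    mul_one_div_cancel (by linarith), Real.rpow_one]

/-- modulated coefficient -/
def aC (lam : ℝ) {m n : ℕ} (g : (Fin m → ℝ) → (Fin n → ℤ) → ℂ) (j : Fin n → ℤ)
    (q : ℝ × (Fin m → ℝ)) : ℂ :=
  Complex.exp (Complex.I * ((-(q.1 * ∑ i, ((j i : ℝ) / lam) ^ 2) : ℝ) : ℂ)) * vf (fun ζ => g ζ j) q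

lemma aC_enorm (lam : ℝ) {m n : ℕ} (g : (Fin m → ℝ) → (Fin n → ℤ) → ℂ) (j : Fin n → ℤ)
    (q : ℝ × (Fin m → ℝ)) : ‖aC lam g j q‖ₑ = ‖vf (fun ζ => g ζ j) q‖ₑ := by
  rw [aC, enorm_mul, mul_comm Complex.I, ← ofReal_norm (Complex.exp _), Complex.norm_exp_ofReal_mul_I]
  simp

lemma aC_cont (lam : ℝ) {m n : ℕ} (g : (Fin m → ℝ) → (Fin n → ℤ) → ℂ) (j : Fin n → ℤ)
    (h : Integrable fun ζ => g ζ j) : Continuous (aC lam g j) := by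
  have := vf_meas h
  unfold aC
  fun_prop

lemma waveU_eq (lam : ℝ) {m n : ℕ} (g : (Fin m → ℝ) → (Fin n → ℤ) → ℂ) (s : Finset (Fin n → ℤ))
    (hs : ∀ ζ j, g ζ j ≠ 0 → j ∈ s) (t : ℝ) (x : Fin m → ℝ) (y : Fin n → ℝ) :
    waveU lam g t x y = ((1 / lam ^ n : ℝ) : ℂ) * ∑ j ∈ s, aC lam g j (t, x) * chE lam y j := by
  rw [waveU]
  congr 1
  have h : ∀ j : Fin n → ℤ, ∫ ζ : Fin m → ℝ,
    g ζ j * Complex.exp (Complex.I *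
      ((((∑ i, x i * ζ i) + ∑ i, y i * ((j i : ℝ) / lam))
        - t * ((∑ i, (ζ i) ^ 2) + ∑ i, ((j i : ℝ) / lam) ^ 2) : ℝ) : ℂ)) =
      aC lam g j (t, x) * chE lam y j := by
    intro j
    rw [aC, vf, chE, mul_right_comm, ← integral_const_mul]
    congr 1; ext ζ
    rw [phE, mul_left_comm, ← Complex.exp_add, ← Complex.exp_add]
    congr 2
    push_cast; ring
  simp_rw [h]
  refine tsum_eq_sum fun j hj => ?_
  have : (fun ζ => g ζ j) = 0 := by
    ext ζ; by_contra h'; exact hj (hs ζ j h')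
  rw [aC, this]
  simp [vf]

lemma supp_box {lam N : ℝ} (hl : 1 ≤ lam) (hN : 1 ≤ N) (n : ℕ) : ∃ s : Finset (Fin n → ℤ),
    (s.card : ℝ) ≤ (5 * N * lam) ^ n ∧
    ∀ j : Fin n → ℤ, (∑ i, ((j i : ℝ) / lam) ^ 2 ≤ (2 * N) ^ 2) → j ∈ s := by
  have hNl : 1 ≤ N * lam := by nlinarith
  refine ⟨Fintype.piFinset fun _ => Finset.Icc (-⌊2 * N * lam⌋) ⌊2 * N * lam⌋, ?_, ?_⟩
  · rw [Fintype.card_piFinset]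
    simp only [Int.card_Icc, Finset.prod_const, Finset.card_univ, Fintype.card_fin]
    push_cast
    gcongr
    have h0 : 0 ≤ ⌊2 * N * lam⌋ := Int.floor_nonneg.2 (by positivity)
    have h1 : (((⌊2 * N * lam⌋ + 1 - -⌊2 * N * lam⌋).toNat : ℤ) : ℝ) = 2 * (⌊2 * N * lam⌋ : ℝ) + 1 := by
      rw [Int.toNat_of_nonneg (by omega)]; push_cast; ring
    have h2 := Int.floor_le (2 * N * lam)
    have h3 : (((⌊2 * N * lam⌋ + 1 - -⌊2 * N * lam⌋).toNat : ℕ) : ℝ) = 2 * (⌊2 * N * lam⌋ : ℝ) + 1 := by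
      rw [← h1, Int.cast_natCast]
    rw [h3]
    nlinarith
  · intro j hj
    rw [Fintype.mem_piFinset]
    intro i
    have h1 : ((j i : ℝ) / lam) ^ 2 ≤ (2 * N) ^ 2 :=
      (Finset.single_le_sum (f := fun i => ((j i : ℝ) / lam) ^ 2) (fun i _ => sq_nonneg _)
        (Finset.mem_univ i)).trans hj
    have h2 := abs_le_of_sq_le_sq h1 (by positivity)
    rw [abs_div, abs_of_pos (by linarith : 0 < lam), div_le_iff₀ (by linarith)] at h2
    have h3 := abs_le.1 h2
    rw [Finset.mem_Icc]
    have h4 : j i ≤ ⌊2 * N * lam⌋ := Int.le_floor.2 h3.2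
    have h5 : -j i ≤ ⌊2 * N * lam⌋ := Int.le_floor.2 (by push_cast; linarith)
    omega

lemma vol_ball_le (m : ℕ) {R : ℝ} (hR : 0 < R) :
    volume {ζ : Fin m → ℝ | ∑ i, ζ i ^ 2 ≤ R ^ 2} ≤ ENNReal.ofReal ((2 * R) ^ m) := by
  calc _ ≤ volume (Set.Icc (fun _ : Fin m => -R) (fun _ => R)) := by
        refine measure_mono fun ζ hζ => ?_
        have hζ : ∑ i, ζ i ^ 2 ≤ R ^ 2 := hζ
        have h : ∀ i, |ζ i| ≤ R := fun i => abs_le_of_sq_le_sq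
          ((Finset.single_le_sum (f := fun i => ζ i ^ 2) (fun i _ => sq_nonneg _)
            (Finset.mem_univ i)).trans hζ) hR.le
        exact ⟨fun i => (abs_le.1 (h i)).1, fun i => (abs_le.1 (h i)).2⟩
    _ = _ := by
        rw [Real.volume_Icc_pi]
        simp only [Finset.prod_const, Finset.card_univ, Fintype.card_fin]
        rw [ENNReal.ofReal_pow (by positivity)]
        congr 2; ring

lemma vf_sup {m : ℕ} {R : ℝ} (hR : 0 < R) (f : (Fin m → ℝ) → ℂ)
    (hf : AEStronglyMeasurable f) (hsupp : ∀ ζ, f ζ ≠ 0 → ∑ i, ζ i ^ 2 ≤ R ^ 2) :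
    (∫⁻ ζ, ‖f ζ‖ₑ) ^ 2 ≤ ENNReal.ofReal ((2 * R) ^ m) * ∫⁻ ζ, ‖f ζ‖ₑ ^ 2 := by
  set S := {ζ : Fin m → ℝ | ∑ i, ζ i ^ 2 ≤ R ^ 2} with hS
  have hSm : MeasurableSet S := measurableSet_le (by fun_prop) (by fun_prop)
  have h := cs_lintegral volume (fun ζ => ‖f ζ‖ₑ) (S.indicator fun _ => 1) hf.enorm
    (measurable_const.indicator hSm).aemeasurable
  have e1 : ∀ ζ, ‖f ζ‖ₑ * S.indicator (fun _ => 1) ζ = ‖f ζ‖ₑ := by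
    intro ζ
    by_cases hz : ζ ∈ S
    · simp [hz]
    · have : f ζ = 0 := by by_contra h'; exact hz (hsupp ζ h')
      simp [this]
  have e2 : ∀ ζ, (S.indicator (fun _ => (1 : ℝ≥0∞)) ζ) ^ 2 = S.indicator (fun _ => 1) ζ := by
    intro ζ
    by_cases hz : ζ ∈ S <;> simp [hz]
  simp_rw [e1, e2] at h
  rw [lintegral_indicator hSm, setLIntegral_const, one_mul] at h
  refine h.trans ?_
  rw [mul_comm]
  gcongr
  exact vol_ball_le m hR

lemma tri_lintegral {X Y Z : Type*} [MeasurableSpace X] [MeasurableSpace Y] [MeasurableSpace Z]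
    (μ : Measure X) (ν : Measure Y) (ρ : Measure Z) [SFinite μ] [SFinite ν] [SFinite ρ]
    {F : X × Y × Z → ℝ≥0∞} (hF : Measurable F) {G : X × Y → ℝ≥0∞} (hG : Measurable G)
    (h : ∀ t x, ∫⁻ y, F (t, x, y) ∂ρ ≤ G (t, x)) :
    ∫⁻ q, F q ∂(μ.prod (ν.prod ρ)) ≤ ∫⁻ q, G q ∂(μ.prod ν) := by
  rw [lintegral_prod _ hF.aemeasurable, lintegral_prod _ hG.aemeasurable]
  refine lintegral_mono fun t => ?_
  have hmt : Measurable fun z : Y × Z => F (t, z) := hF.comp measurable_prodMk_left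
  rw [lintegral_prod _ hmt.aemeasurable]
  exact lintegral_mono fun x => h t x

set_option maxHeartbeats 800000 in
lemma core (m n : ℕ) (hm : 2 ≤ m) : ∃ D : ℝ, 0 < D ∧
    ∀ (lam N : ℝ) (g : (Fin m → ℝ) → (Fin n → ℤ) → ℂ), 1 ≤ lam → 1 ≤ N →
    (∀ ζ j, g ζ j ≠ 0 → (∑ i, ζ i ^ 2) + ∑ i, ((j i : ℝ) / lam) ^ 2 ≤ (2 * N) ^ 2) →
    (∀ j, Integrable fun ζ => g ζ j) →
    (∀ q : ℝ × (Fin m → ℝ) × (Fin n → ℝ), ‖waveU lam g q.1 q.2.1 q.2.2‖ₑ ^ 2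
      ≤ ENNReal.ofReal (5 ^ n * 4 ^ m * N ^ (m + n)) * l2sq lam g) ∧
    ∫⁻ q : ℝ × (Fin m → ℝ) × (Fin n → ℝ), ‖waveU lam g q.1 q.2.1 q.2.2‖ₑ ^ 4
      ∂((volume : Measure ℝ).prod ((volume : Measure (Fin m → ℝ)).prod
            ((volume : Measure (Fin n → ℝ)).restrict (torusBox lam n))))
      ≤ ENNReal.ofReal (D * N ^ (m - 2 + n)) * (l2sq lam g) ^ 2 := by
  obtain ⟨C, hC, hL4⟩ := L4R m hm
  refine ⟨C * 2 ^ (m - 2) * (10 * Real.pi) ^ n, by positivity, fun lam N g hl hN hsupp hgint => ?_⟩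
  obtain ⟨s, hcard, hs⟩ := supp_box hl hN n
  have hl0 : 0 < lam := by linarith
  have hN0 : 0 < N := by linarith
  have hsz : ∀ ζ j, g ζ j ≠ 0 → j ∈ s := fun ζ j h => hs j (by
    have := hsupp ζ j h
    have : 0 ≤ ∑ i, ζ i ^ 2 := Finset.sum_nonneg fun i _ => sq_nonneg _
    linarith)
  have hsζ : ∀ j ζ, g ζ j ≠ 0 → ∑ i, ζ i ^ 2 ≤ (2 * N) ^ 2 := fun j ζ h => by
    have := hsupp ζ j h
    have : 0 ≤ ∑ i, ((j i : ℝ) / lam) ^ 2 := Finset.sum_nonneg fun i _ => sq_nonneg _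
    linarith
  set c : (Fin n → ℤ) → ℝ≥0∞ := fun j => ∫⁻ ζ, ‖g ζ j‖ₑ ^ 2 with hc
  set K : ℝ≥0∞ := (s.card : ℝ≥0∞) with hK
  have hKle : K ≤ ENNReal.ofReal ((5 * N * lam) ^ n) := by
    have := ENNReal.ofReal_le_ofReal hcard
    simpa using this
  set ℓ : ℝ≥0∞ := ENNReal.ofReal (1 / lam ^ n) with hℓ
  have hl2 : l2sq lam g = ℓ * ∑ j ∈ s, c j := by
    rw [l2sq]
    congr 1
    refine tsum_eq_sum fun j hj => ?_
    have : ∀ ζ, g ζ j = 0 := fun ζ => by by_contra h'; exact hj (hsz ζ j h')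
    simp [this]
  have hu : ∀ t x y, ‖waveU lam g t x y‖ₑ = ℓ * ‖∑ j ∈ s, aC lam g j (t, x) * chE lam y j‖ₑ := by
    intro t x y
    rw [waveU_eq lam g s hsz, enorm_mul]
    congr 1
    rw [← ofReal_norm, Complex.norm_real, Real.norm_of_nonneg (by positivity)]
  set A : (Fin n → ℤ) → ℝ × (Fin m → ℝ) → ℝ≥0∞ := fun j q => ‖vf (fun ζ => g ζ j) q‖ₑ ^ 2 with hA
  have hAm : ∀ j, Measurable (A j) := fun j => (vf_meas (hgint j)).measurable.enorm.pow_const 2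
  have hP : ∀ t x y, ‖∑ j ∈ s, aC lam g j (t, x) * chE lam y j‖ₑ ^ 2 ≤ K * ∑ j ∈ s, A j (t, x) := by
    intro t x y
    refine (enorm_sum_sq_le s _).trans (le_of_eq ?_)
    congr 1
    refine Finset.sum_congr rfl fun j _ => ?_
    rw [enorm_mul, aC_enorm, ← ofReal_norm (chE lam y j), chE_norm]
    simp [hA]
  refine ⟨?_, ?_⟩
  · rintro ⟨t, x, y⟩
    simp only [hu]
    have hAsup : ∀ j, A j (t, x) ≤ ENNReal.ofReal ((4 * N) ^ m) * c j := by
      intro j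
      have h1 : ‖vf (fun ζ => g ζ j) (t, x)‖ₑ ≤ ∫⁻ ζ, ‖g ζ j‖ₑ := by
        refine (enorm_integral_le_lintegral_enorm _).trans (le_of_eq ?_)
        refine lintegral_congr fun ζ => ?_
        rw [enorm_mul, ← ofReal_norm (phE _ _), phE_norm]; simp
      calc A j (t, x) ≤ (∫⁻ ζ, ‖g ζ j‖ₑ) ^ 2 := by simp only [hA]; gcongr
        _ ≤ _ := vf_sup (R := 2 * N) (by positivity) _ (hgint j).1 (hsζ j)
        _ = _ := by congr 3; ring
    calc _ = ℓ ^ 2 * ‖∑ j ∈ s, aC lam g j (t, x) * chE lam y j‖ₑ ^ 2 := mul_pow _ _ _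
      _ ≤ ℓ ^ 2 * (K * ∑ j ∈ s, A j (t, x)) := by gcongr; exact hP t x y
      _ ≤ ℓ ^ 2 * (ENNReal.ofReal ((5 * N * lam) ^ n) * ∑ j ∈ s, ENNReal.ofReal ((4 * N) ^ m) * c j) := by
          gcongr with j hj
          exact hAsup j
      _ = (ℓ * ENNReal.ofReal ((5 * N * lam) ^ n) * ENNReal.ofReal ((4 * N) ^ m)) * (ℓ * ∑ j ∈ s, c j) := by
          rw [← Finset.mul_sum]; ring
      _ = _ := by
          rw [hl2, hℓ, ← ENNReal.ofReal_mul (by positivity), ← ENNReal.ofReal_mul (by positivity)]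
          congr 2
          simp only [mul_pow, pow_add]
          field_simp
  · have haC : ∀ j, Continuous (aC lam g j) := fun j => aC_cont lam g j (hgint j)
    have hmeas : Measurable fun q : ℝ × (Fin m → ℝ) × (Fin n → ℝ) => ‖waveU lam g q.1 q.2.1 q.2.2‖ₑ ^ 4 := by
      simp only [hu]
      have : Continuous fun q : ℝ × (Fin m → ℝ) × (Fin n → ℝ) =>
          ∑ j ∈ s, aC lam g j (q.1, q.2.1) * chE lam q.2.2 j :=
        continuous_finsetSum _ fun j _ => ((haC j).comp (by fun_prop)).mul
          ((chE_cont lam j).comp (by fun_prop))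
      exact (measurable_const.mul this.measurable.enorm).pow_const 4
    have hinner : ∀ t x, ∫⁻ y in torusBox lam n, ‖waveU lam g t x y‖ₑ ^ 4 ≤
        ℓ ^ 4 * (K * ENNReal.ofReal ((2 * Real.pi * lam) ^ n)) * (∑ j ∈ s, A j (t, x)) ^ 2 := by
      intro t x
      have hfin : K * ∑ j ∈ s, A j (t, x) ≠ ⊤ := by
        refine ENNReal.mul_ne_top (by simp [hK]) ?_
        exact ENNReal.sum_ne_top.2 fun j _ => by simp [hA]
      calc _ ≤ ∫⁻ y in torusBox lam n, (ℓ ^ 4 * (K * ∑ j ∈ s, A j (t, x))) *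
            ‖∑ j ∈ s, aC lam g j (t, x) * chE lam y j‖ₑ ^ 2 := by
            refine lintegral_mono fun y => ?_
            simp only [hu]
            rw [mul_pow, show 4 = 2 + 2 by norm_num, pow_add (‖_‖ₑ), ← mul_assoc]
            gcongr
            exact hP t x y
        _ = _ := by
            rw [lintegral_const_mul' _ _ (ENNReal.mul_ne_top (by simp [hℓ]) hfin), parseval hl0,
              ENNReal.ofReal_mul (by positivity), ENNReal.ofReal_sum_of_nonneg (fun i _ => by positivity)]
            have : ∀ j, ENNReal.ofReal (‖aC lam g j (t, x)‖ ^ 2) = A j (t, x) := by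
              intro j
              rw [ENNReal.ofReal_pow (norm_nonneg _), ofReal_norm, aC_enorm]
            simp_rw [this]
            ring
    have hsum : ∫⁻ q, (∑ j ∈ s, A j q) ^ 2 ≤ ENNReal.ofReal (C * (2 * N) ^ (m - 2)) * (∑ j ∈ s, c j) ^ 2 := by
      refine sum_sq_lintegral _ s A (fun j => (hAm j).aemeasurable) _ c fun j => ?_
      have := hL4 (2 * N) (by positivity) _ (hgint j) (hsζ j)
      simpa only [hA, hc, ← pow_mul] using this
    have hsm : Measurable fun q => (∑ j ∈ s, A j q) ^ 2 :=
      (Finset.measurable_fun_sum _ fun j _ => hAm j).pow_const 2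
    calc _ ≤ ∫⁻ q : ℝ × (Fin m → ℝ),
          ℓ ^ 4 * (K * ENNReal.ofReal ((2 * Real.pi * lam) ^ n)) * (∑ j ∈ s, A j q) ^ 2 :=
          tri_lintegral volume volume _ hmeas (hsm.const_mul _) hinner
      _ ≤ ℓ ^ 4 * (K * ENNReal.ofReal ((2 * Real.pi * lam) ^ n)) *
          (ENNReal.ofReal (C * (2 * N) ^ (m - 2)) * (∑ j ∈ s, c j) ^ 2) := by
          rw [lintegral_const_mul _ hsm]
          gcongr
      _ ≤ ℓ ^ 4 * (ENNReal.ofReal ((5 * N * lam) ^ n) * ENNReal.ofReal ((2 * Real.pi * lam) ^ n)) *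
          (ENNReal.ofReal (C * (2 * N) ^ (m - 2)) * (∑ j ∈ s, c j) ^ 2) := by
          gcongr
      _ = (ℓ * ℓ * ENNReal.ofReal ((5 * N * lam) ^ n) * ENNReal.ofReal ((2 * Real.pi * lam) ^ n) *
          ENNReal.ofReal (C * (2 * N) ^ (m - 2))) * (ℓ * ∑ j ∈ s, c j) ^ 2 := by ring
      _ = _ := by
          rw [hl2, hℓ, ← ENNReal.ofReal_mul (by positivity), ← ENNReal.ofReal_mul (by positivity),
            ← ENNReal.ofReal_mul (by positivity), ← ENNReal.ofReal_mul (by positivity)]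
          congr 2
          rw [show (10 * Real.pi) = 5 * (2 * Real.pi) by ring]
          simp only [mul_pow, pow_add]
          field_simp

/-- **Global-in-time `L^p` Strichartz estimate on `ℝ^m × 𝕋ⁿ_λ`, `m ≥ 2`, `p ∈ [4,∞]`.**
The space-time `L^p` norm is expressed as an `eLpNorm` with respect to the product of
Lebesgue measure in `t ∈ ℝ`, Lebesgue measure in `x ∈ ℝ^m` and Lebesgue measure restricted
to one period box in `y`; for `p = ∞` the exponent `d/2 − (d+2)/p` becomes `d/2`
(via `p.toReal = 0`) and the norm is the essential supremum. -/
theorem global_strichartz_Lp (m n : ℕ) (hm : 2 ≤ m) (hn : 1 ≤ n)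
    (p : ℝ≥0∞) (hp : 4 ≤ p) :
    ∃ C : ℝ, 0 < C ∧
    ∀ (lam N : ℝ) (g : (Fin m → ℝ) → (Fin n → ℤ) → ℂ),
      1 ≤ lam → IsDyadic N → SuppIn lam g N →
      eLpNorm (fun q : ℝ × (Fin m → ℝ) × (Fin n → ℝ) => waveU lam g q.1 q.2.1 q.2.2) p
          ((volume : Measure ℝ).prod ((volume : Measure (Fin m → ℝ)).prod
            ((volume : Measure (Fin n → ℝ)).restrict (torusBox lam n))))
        ≤ ENNReal.ofReal
            (C * N ^ (((m : ℝ) + n) / 2 - (((m : ℝ) + n) + 2) / p.toReal))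
          * (l2sq lam g) ^ (1 / 2 : ℝ) := by
  obtain ⟨D, hD, hcore⟩ := core m n hm
  set D1 : ℝ := Real.sqrt (5 ^ n * 4 ^ m) with hD1
  have hD1p : 0 < D1 := by positivity
  refine ⟨if p = ⊤ then D1 else (D1 ^ (p.toReal - 4) * D) ^ (1 / p.toReal), ?_, ?_⟩
  · split_ifs <;> positivity
  set CC : ℝ := if p = ⊤ then D1 else (D1 ^ (p.toReal - 4) * D) ^ (1 / p.toReal) with hCC
  have hCCp : 0 < CC := by rw [hCC]; split_ifs <;> positivity
  intro lam N g hl hNd hsupp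
  have hN : 1 ≤ N := by
    obtain ⟨a, rfl⟩ := hNd
    exact one_le_pow₀ (by norm_num)
  have hN0 : 0 < N := by linarith
  have hl0 : 0 < lam := by linarith
  -- replace the non-measurable slices by zero
  set g' : (Fin m → ℝ) → (Fin n → ℤ) → ℂ := fun ζ j =>
    if AEStronglyMeasurable (fun ζ => g ζ j) volume then g ζ j else 0 with hg'
  have hwave : ∀ t x y, waveU lam g t x y = waveU lam g' t x y := by
    intro t x y
    rw [waveU, waveU]
    congr 1
    refine tsum_congr fun j => ?_
    by_cases hj : AEStronglyMeasurable (fun ζ => g ζ j) volume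
    · simp only [hg', if_pos hj]
    · simp only [hg', if_neg hj, zero_mul, integral_zero]
      refine integral_undef fun hI => hj ?_
      have hcont : Continuous fun ζ : Fin m → ℝ => Complex.exp (-(Complex.I *
        ((((∑ i, x i * ζ i) + ∑ i, y i * ((j i : ℝ) / lam))
        - t * ((∑ i, (ζ i) ^ 2) + ∑ i, ((j i : ℝ) / lam) ^ 2) : ℝ) : ℂ))) := by fun_prop
      refine (hI.1.mul hcont.aestronglyMeasurable).congr (Filter.Eventually.of_forall fun ζ => ?_)
      simp only [Pi.mul_apply]
      rw [mul_assoc, ← Complex.exp_add, add_neg_cancel, Complex.exp_zero, mul_one]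
  have hl2le : l2sq lam g' ≤ l2sq lam g := by
    unfold l2sq
    gcongr with j ζ
    by_cases hj : AEStronglyMeasurable (fun ζ => g ζ j) volume
    · simp only [hg', if_pos hj]; exact le_rfl
    · simp only [hg', if_neg hj]; simp
  have hg'ne : ∀ ζ j, g' ζ j ≠ 0 → g ζ j ≠ 0 := by
    intro ζ j h h0
    apply h
    simp only [hg', h0, ite_self]
  have hsupp' : ∀ ζ j, g' ζ j ≠ 0 → (∑ i, ζ i ^ 2) + ∑ i, ((j i : ℝ) / lam) ^ 2 ≤ (2 * N) ^ 2 := by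
    intro ζ j h
    have := (hsupp ζ j (hg'ne ζ j h)).1
    rw [freqNorm] at this
    exact (Real.sqrt_le_left (by positivity)).1 this
  simp_rw [hwave]
  refine le_trans ?_ (mul_le_mul_right (ENNReal.rpow_le_rpow hl2le (by norm_num)) _)
  by_cases htop : l2sq lam g' = ⊤
  · rw [htop, ENNReal.top_rpow_of_pos (by norm_num), ENNReal.mul_top]
    · exact le_top
    · exact (ENNReal.ofReal_pos.2 (by positivity)).ne'
  have hmeas' : ∀ j, AEStronglyMeasurable (fun ζ => g' ζ j) volume := by
    intro j
    by_cases hj : AEStronglyMeasurable (fun ζ => g ζ j) volume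
    · simp only [hg', if_pos hj]; exact hj
    · simp only [hg', if_neg hj]; exact aestronglyMeasurable_const
  have hfin : ∀ j, ∫⁻ ζ, ‖g' ζ j‖ₑ ^ 2 ≠ ⊤ := by
    intro j hj
    apply htop
    rw [l2sq, ENNReal.tsum_eq_top_of_eq_top ⟨j, hj⟩, ENNReal.mul_top]
    exact (ENNReal.ofReal_pos.2 (by positivity)).ne'
  have hgint : ∀ j, Integrable fun ζ => g' ζ j := by
    intro j
    refine ⟨hmeas' j, ?_⟩
    have h1 := vf_sup (R := 2 * N) (by positivity) (fun ζ => g' ζ j) (hmeas' j) (fun ζ h => by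
      have := hsupp' ζ j h
      have : 0 ≤ ∑ i, ((j i : ℝ) / lam) ^ 2 := Finset.sum_nonneg fun i _ => sq_nonneg _
      linarith)
    have h2 := h1.trans_lt (ENNReal.mul_lt_top (by simp) (hfin j).lt_top)
    rw [HasFiniteIntegral]
    by_contra h3
    rw [not_lt_top_iff.1 h3] at h2
    simp at h2
  obtain ⟨hsup, h4⟩ := hcore lam N g' hl hN hsupp' hgint
  set r : ℝ := Real.sqrt (l2sq lam g').toReal with hr
  have hr0 : 0 ≤ r := Real.sqrt_nonneg _
  have hLr : l2sq lam g' = ENNReal.ofReal (r ^ 2) := by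
    rw [hr, Real.sq_sqrt ENNReal.toReal_nonneg, ENNReal.ofReal_toReal htop]
  have hLr2 : (l2sq lam g') ^ (1 / 2 : ℝ) = ENNReal.ofReal r := by
    rw [hLr, ENNReal.ofReal_rpow_of_nonneg (by positivity) (by norm_num), ← Real.sqrt_eq_rpow,
      Real.sqrt_sq hr0]
  rw [hLr2, ← ENNReal.ofReal_mul (by positivity)]
  set M : ℝ := D1 * N ^ (((m : ℝ) + n) / 2) with hM
  have hM2 : M ^ 2 = 5 ^ n * 4 ^ m * N ^ (m + n) := by
    rw [hM, mul_pow, hD1, Real.sq_sqrt (by positivity), ← Real.rpow_natCast (N ^ _) 2,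
      ← Real.rpow_mul hN0.le, ← Real.rpow_natCast N (m + n)]
    congr 2; push_cast; ring
  have hsup' : ∀ q : ℝ × (Fin m → ℝ) × (Fin n → ℝ),
      ‖waveU lam g' q.1 q.2.1 q.2.2‖ₑ ≤ ENNReal.ofReal (M * r) := by
    intro q
    have := hsup q
    rw [hLr, ← hM2, ← ENNReal.ofReal_mul (by positivity), ← mul_pow,
      ENNReal.ofReal_pow (by positivity)] at this
    exact (ENNReal.pow_le_pow_left_iff (by norm_num)).1 this
  by_cases hpt : p = ⊤
  · have : CC = D1 := by rw [hCC, if_pos hpt]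
    rw [this, hpt, eLpNorm_exponent_top]
    simp only [ENNReal.toReal_top, div_zero, sub_zero]
    exact eLpNormEssSup_le_of_ae_enorm_bound (Filter.Eventually.of_forall hsup')
  · have hCe : CC = (D1 ^ (p.toReal - 4) * D) ^ (1 / p.toReal) := by rw [hCC, if_neg hpt]
    have hp4 : 4 ≤ p.toReal := by
      have := ENNReal.toReal_mono hpt hp
      simpa using this
    have hp0 : 0 < p.toReal := by linarith
    refine (interp _ _ p hp hpt M (D * N ^ (m - 2 + n)) r (by positivity) (by positivity) hr0 hsup' ?_).trans
      (le_of_eq ?_)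
    · refine h4.trans (le_of_eq ?_)
      rw [hLr, ← ENNReal.ofReal_pow (by positivity), ← ENNReal.ofReal_mul (by positivity)]
      congr 1; ring
    · congr 2
      rw [hCe, hM, Real.mul_rpow (x := D1) (y := N ^ (((m : ℝ) + n) / 2)) (by positivity) (by positivity), ← Real.rpow_mul hN0.le,
        ← Real.rpow_natCast N (m - 2 + n)]
      rw [show D1 ^ (p.toReal - 4) * N ^ (((m : ℝ) + n) / 2 * (p.toReal - 4)) *
          (D * N ^ (((m - 2 + n : ℕ) : ℝ))) = (D1 ^ (p.toReal - 4) * D) *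
          (N ^ (((m : ℝ) + n) / 2 * (p.toReal - 4)) * N ^ (((m - 2 + n : ℕ) : ℝ))) by ring,
        ← Real.rpow_add hN0, Real.mul_rpow (by positivity) (by positivity), ← Real.rpow_mul hN0.le]
      congr 2
      push_cast [Nat.cast_sub hm]
      field_simp
      ring
end
end

section
/- Let m ≥ 2, n ≥ 1 be integers, d = m + n, let p ∈ [4, ∞] and let q be defined by 1/p + 1/q = 1/2 (so q = 2 when p = ∞). There is a constant C = C(m,n,p) > 0 such that for every λ ≥ 1, every dyadic integer N ≥ 1, and every g : ℝ^m×(1/λ)ℤⁿ → ℂ supported in {k : |k| ≤ 2N, and moreover |k| ≥ N/2 when N > 1}, one has the global-in-time mixed-norm Strichartz estimate ‖U_λ g‖_{L^p_t L^q_{z}(ℝ×ℝ^m×𝕋ⁿ_λ)} ≤ C N^{(d−2)/p} ‖g‖_{L²_λ}. -/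
noncomputable section
open MeasureTheory
open scoped ENNReal NNReal Classical

/-- The spatial `L^q` norm (as an `ℝ≥0∞`-valued quantity) of `z ↦ u z` on `ℝ^m × 𝕋ⁿ_λ`,
for a real exponent `q > 0`. -/
def spatialLq (lam : ℝ) {m n : ℕ} (q : ℝ) (u : (Fin m → ℝ) → (Fin n → ℝ) → ℂ) : ℝ≥0∞ :=
  (∫⁻ x : Fin m → ℝ, ∫⁻ y in torusBox lam n, (‖u x y‖₊ : ℝ≥0∞) ^ q) ^ (1 / q)

/-- The mixed norm `‖u‖_{L^p_t L^q_z}` over `ℝ × ℝ^m × 𝕋ⁿ_λ`, with the usual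
essential-supremum modification when `p = ∞`. -/
def mixedLpLq (lam : ℝ) {m n : ℕ} (p : ℝ≥0∞) (q : ℝ)
    (u : ℝ → (Fin m → ℝ) → (Fin n → ℝ) → ℂ) : ℝ≥0∞ :=
  if p = ⊤ then essSup (fun t : ℝ => spatialLq lam q (u t)) volume
  else (∫⁻ t : ℝ, (spatialLq lam q (u t)) ^ p.toReal) ^ (1 / p.toReal)

section
open scoped FourierTransform SchwartzMap

lemma fourier_L1_L2_ae (f : ℝ → ℂ) (h1 : Integrable f) (h2 : MemLp f 2 volume) :
    (𝓕 (h2.toLp f) : Lp ℂ 2 (volume : Measure ℝ)) =ᵐ[volume] 𝓕 f := by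
  apply ae_eq_of_integral_contDiff_smul_eq
  · exact (Lp.memLp _).locallyIntegrable (by norm_num)
  · have : Continuous (𝓕 f) := 
      VectorFourier.fourierIntegral_continuous Real.continuous_fourierChar
        (by exact continuous_inner) h1
    exact this.locallyIntegrable
  · intro g hg hgc
    let G : 𝓢(ℝ, ℂ) := HasCompactSupport.toSchwartzMap (f := fun x => (g x : ℂ))
      (hgc.comp_left (g := fun x : ℝ => (x : ℂ)) (by simp))
      (Complex.ofRealCLM.contDiff.comp hg)
    have hG : ∀ x, G x = (g x : ℂ) := fun x => rfl
    have e1 := congrArg (fun T => T G) (Lp.fourier_toTemperedDistribution_eq (h2.toLp f))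
    simp only [TemperedDistribution.fourier_apply, Lp.toTemperedDistribution_apply] at e1
    have e2 : ∫ x, (𝓕 G) x • f x = ∫ x, G x • (𝓕 f) x := by
      have := VectorFourier.integral_fourierIntegral_smul_eq_flip (L := innerₗ ℝ) (μ := volume) (ν := volume)
        Real.continuous_fourierChar (by exact continuous_inner) (G.integrable (μ := volume)) h1
      simp only [flip_innerₗ] at this
      exact this
    have e3 : ∫ x, (𝓕 G) x • (h2.toLp f) x = ∫ x, (𝓕 G) x • f x := by
      apply integral_congr_ae
      filter_upwards [h2.coeFn_toLp] with x hx
      rw [hx]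
    rw [e3, e2] at e1
    simpa [hG] using e1.symm

lemma plancherel_R (f : ℝ → ℂ) (hf : Measurable f) :
    ∫⁻ x : ℝ, ‖∫ k, f k * Complex.exp (Complex.I * ((x * k : ℝ) : ℂ))‖ₑ ^ 2
      ≤ ENNReal.ofReal (2 * Real.pi) * ∫⁻ k, ‖f k‖ₑ ^ 2 := by
  by_cases h1 : Integrable f
  swap
  · have : ∀ x : ℝ, ∫ k, f k * Complex.exp (Complex.I * ((x * k : ℝ) : ℂ)) = 0 := by
      intro x
      apply integral_undef
      intro h
      apply h1
      have := h.mul_bdd (c := 1) (g := fun k : ℝ => Complex.exp (-(Complex.I * ((x * k : ℝ) : ℂ)))) (by fun_prop)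
        (by
          refine Filter.Eventually.of_forall fun k => ?_
          have := Complex.norm_exp_I_mul_ofReal (-(x * k))
          push_cast at this ⊢
          rw [← mul_neg, this])
      refine this.congr (Filter.Eventually.of_forall fun k => ?_)
      simp [mul_assoc, ← Complex.exp_add]
    simp_rw [this]
    simp
  by_cases h2 : ∫⁻ k, ‖f k‖ₑ ^ 2 = ⊤
  · rw [h2, ENNReal.mul_top (by positivity)]
    exact le_top
  have hL2 : MemLp f 2 volume := by
    refine ⟨hf.aestronglyMeasurable, ?_⟩
    rw [eLpNorm_lt_top_iff_lintegral_rpow_enorm_lt_top (by norm_num) (by norm_num)]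
    simpa using lt_top_iff_ne_top.2 h2
  have key : ∫⁻ w, ‖𝓕 f w‖ₑ ^ 2 = ∫⁻ k, ‖f k‖ₑ ^ 2 := by
    have a : eLpNorm (𝓕 f) 2 volume = eLpNorm f 2 volume := by
      rw [← eLpNorm_congr_ae (fourier_L1_L2_ae f h1 hL2)]
      have := Lp.norm_fourier_eq (hL2.toLp f)
      rw [← eLpNorm_congr_ae hL2.coeFn_toLp]
      rw [Lp.norm_def, Lp.norm_def, ENNReal.toReal_eq_toReal_iff' (Lp.eLpNorm_ne_top _) (Lp.eLpNorm_ne_top _)] at this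
      exact this
    have b := congrArg (fun z => z ^ (2:ℝ)) a
    simp only [eLpNorm_eq_lintegral_rpow_enorm_toReal (p := 2) (by norm_num) (by norm_num)] at b
    simp only [← ENNReal.rpow_mul] at b
    simpa using b
  rw [← key]
  have e : ∀ x : ℝ, ∫ k, f k * Complex.exp (Complex.I * ((x * k : ℝ) : ℂ)) = 𝓕 f ((-(2 * Real.pi)⁻¹) * x) := by
    intro x
    rw [Real.fourier_eq']
    congr 1
    ext k
    rw [smul_eq_mul, mul_comm]
    congr 2
    rw [mul_comm]
    congr 2
    simp
    field_simp
  simp_rw [e]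
  have hm : Measurable fun w => ‖𝓕 f w‖ₑ ^ 2 := by
    have : Continuous (𝓕 f) := 
      VectorFourier.fourierIntegral_continuous Real.continuous_fourierChar
        (by exact continuous_inner) h1
    exact (this.measurable.enorm).pow_const 2
  have := lintegral_map (μ := (volume : Measure ℝ)) hm (measurable_const_mul (-(2 * Real.pi)⁻¹))
  rw [← this, Real.map_volume_mul_left (by simp [Real.pi_ne_zero]), lintegral_smul_measure]
  apply le_of_eq
  simp [abs_of_pos Real.pi_pos]

end

lemma integrable_mul_unit {K : Type*} [MeasurableSpace K] {ν : Measure K} {f e : K → ℂ}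
    (he : Measurable e) (h1 : ∀ k, ‖e k‖ = 1) :
    Integrable (fun k => f k * e k) ν ↔ Integrable f ν := by
  constructor
  · intro h
    have := h.mul_bdd (c := 1) (g := fun k => (e k)⁻¹) (he.inv.aestronglyMeasurable)
        (Filter.Eventually.of_forall fun k => by simp [h1])
    refine this.congr (Filter.Eventually.of_forall fun k => ?_)
    have : e k ≠ 0 := by
      intro h0; have := h1 k; simp [h0] at this
    simp [this]
  · intro h
    exact h.mul_bdd (c := 1) he.aestronglyMeasurable (Filter.Eventually.of_forall fun k => by simp [h1])

lemma enorm_unit {z : ℂ} (h : ‖z‖ = 1) : ‖z‖ₑ = 1 := by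
  rw [← ofReal_norm, h]; simp

/-- Plancherel inequality for the kernel `e`. -/
def PL {X K : Type*} [MeasurableSpace X] [MeasurableSpace K] (μ : Measure X) (ν : Measure K)
    (e : X → K → ℂ) (C : ℝ≥0∞) : Prop :=
  ∀ f : K → ℂ, Measurable f →
    ∫⁻ x, ‖∫ k, f k * e x k ∂ν‖ₑ ^ 2 ∂μ ≤ C * ∫⁻ k, ‖f k‖ₑ ^ 2 ∂ν

lemma PL_equiv {X K X' K' : Type*} [MeasurableSpace X] [MeasurableSpace K]
    [MeasurableSpace X'] [MeasurableSpace K'] {μ : Measure X} {ν : Measure K}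
    {μ' : Measure X'} {ν' : Measure K'} {e : X → K → ℂ} {e' : X' → K' → ℂ} {C : ℝ≥0∞}
    (φ : X' ≃ᵐ X) (ψ : K' ≃ᵐ K) (hφ : MeasurePreserving φ μ' μ) (hψ : MeasurePreserving ψ ν' ν)
    (he : ∀ x k, e (φ x) (ψ k) = e' x k) (h : PL μ ν e C) : PL μ' ν' e' C := by
  intro f hf
  have := h (fun k => f (ψ.symm k)) (hf.comp ψ.symm.measurable)
  rw [← hφ.lintegral_comp_emb φ.measurableEmbedding, ← hψ.lintegral_comp_emb ψ.measurableEmbedding] at this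
  simpa [← hψ.integral_comp ψ.measurableEmbedding, he] using this

lemma measurable_param {X K : Type*} [MeasurableSpace X] [MeasurableSpace K]
    {ν : Measure K} [SFinite ν] {F : X → K → ℂ} (h : Measurable (Function.uncurry F)) :
    Measurable fun x => ∫ k, F x k ∂ν :=
  (h.stronglyMeasurable.integral_prod_right (ν := ν)).measurable

lemma PL_prod {X K X' K' : Type*} [MeasurableSpace X] [MeasurableSpace K]
    [MeasurableSpace X'] [MeasurableSpace K'] {μ : Measure X} {ν : Measure K}
    {μ' : Measure X'} {ν' : Measure K'} [SFinite μ] [SFinite ν] [SFinite μ'] [SFinite ν']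
    {e : X → K → ℂ} {e' : X' → K' → ℂ} {C C' : ℝ≥0∞}
    (he : Measurable (Function.uncurry e)) (he' : Measurable (Function.uncurry e'))
    (h1 : ∀ x k, ‖e x k‖ = 1) (h1' : ∀ x k, ‖e' x k‖ = 1)
    (h : PL μ ν e C) (h' : PL μ' ν' e' C') :
    PL (μ.prod μ') (ν.prod ν') (fun x k => e x.1 k.1 * e' x.2 k.2) (C * C') := by
  intro f hf
  have hem : ∀ x, Measurable (e x) := fun x => he.comp (measurable_const.prodMk measurable_id)
  have hem' : ∀ x, Measurable (e' x) := fun x => he'.comp (measurable_const.prodMk measurable_id)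
  by_cases hi : Integrable f (ν.prod ν')
  swap
  · have : ∀ x : X × X', ∫ k, f k * (e x.1 k.1 * e' x.2 k.2) ∂(ν.prod ν') = 0 := by
      intro x
      apply integral_undef
      rw [integrable_mul_unit]
      · exact hi
      · exact ((hem _).comp measurable_fst).mul ((hem' _).comp measurable_snd)
      · intro k; simp [h1, h1']
    simp_rw [this]
    simp
  have hfe : ∀ x : X × X', ∫ k, f k * (e x.1 k.1 * e' x.2 k.2) ∂(ν.prod ν')
      = ∫ k, (∫ k', f (k, k') * e' x.2 k' ∂ν') * e x.1 k ∂ν := by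
    intro x
    rw [integral_prod]
    · congr 1
      ext k
      rw [← integral_mul_const]
      congr 1
      ext k'
      ring
    · rw [integrable_mul_unit]
      · exact hi
      · exact ((hem _).comp measurable_fst).mul ((hem' _).comp measurable_snd)
      · intro k; simp [h1, h1']
  simp_rw [hfe]
  have m1 : Measurable fun p : X' × K => ∫ k', f (p.2, k') * e' p.1 k' ∂ν' := by
    apply measurable_param
    apply Measurable.mul
    · exact hf.comp (by fun_prop)
    · exact he'.comp (f := fun q : (X' × K) × K' => (q.1.1, q.2)) (by fun_prop)
  have m2 : Measurable fun x : X × X' => ‖∫ k, (∫ k', f (k, k') * e' x.2 k' ∂ν') * e x.1 k ∂ν‖ₑ ^ 2 := by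
    apply Measurable.pow_const
    apply Measurable.enorm
    apply measurable_param
    apply Measurable.mul
    · exact m1.comp (f := fun q : (X × X') × K => (q.1.2, q.2)) (by fun_prop)
    · exact he.comp (f := fun q : (X × X') × K => (q.1.1, q.2)) (by fun_prop)
  rw [lintegral_prod_symm _ m2.aemeasurable]
  calc ∫⁻ x', ∫⁻ x, ‖∫ k, (∫ k', f (k, k') * e' x' k' ∂ν') * e x k ∂ν‖ₑ ^ 2 ∂μ ∂μ'
      ≤ ∫⁻ x', C * ∫⁻ k, ‖∫ k', f (k, k') * e' x' k' ∂ν'‖ₑ ^ 2 ∂ν ∂μ' := by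
        apply lintegral_mono
        intro x'
        exact h _ (m1.comp (measurable_const.prodMk measurable_id))
    _ = C * ∫⁻ k, ∫⁻ x', ‖∫ k', f (k, k') * e' x' k' ∂ν'‖ₑ ^ 2 ∂μ' ∂ν := by
        rw [lintegral_const_mul, lintegral_lintegral_swap]
        · exact (m1.enorm.pow_const 2).aemeasurable
        · exact (m1.enorm.pow_const 2).lintegral_prod_right'
    _ ≤ C * ∫⁻ k, C' * ∫⁻ k', ‖f (k, k')‖ₑ ^ 2 ∂ν' ∂ν := by
        gcongr with k
        exact h' _ (hf.comp (measurable_const.prodMk measurable_id))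
    _ = C * C' * ∫⁻ k, ‖f k‖ₑ ^ 2 ∂(ν.prod ν') := by
        rw [lintegral_const_mul, lintegral_prod, mul_assoc]
        · exact (hf.enorm.pow_const 2).aemeasurable
        · exact (hf.enorm.pow_const 2).lintegral_prod_right'

lemma PL_pi {X K : Type*} [MeasurableSpace X] [MeasurableSpace K]
    {μ : Measure X} {ν : Measure K} [SigmaFinite μ] [SigmaFinite ν]
    {e : X → K → ℂ} {C : ℝ≥0∞}
    (he : Measurable (Function.uncurry e)) 
    (h1 : ∀ x k, ‖e x k‖ = 1) 
    (h : PL μ ν e C) (n : ℕ) :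
    PL (Measure.pi fun _ : Fin n => μ) (Measure.pi fun _ : Fin n => ν) 
      (fun x k => ∏ i, e (x i) (k i)) (C ^ n) := by
  induction n with
  | zero =>
    intro f hf
    rw [Measure.pi_of_empty, Measure.pi_of_empty]
    simp
  | succ n ih =>
    rw [pow_succ']
    have hm : Measurable (Function.uncurry fun (x : Fin n → X) (k : Fin n → K) => ∏ i, e (x i) (k i)) := by
      apply Finset.measurable_prod
      intro i _
      exact he.comp (f := fun q : (Fin n → X) × (Fin n → K) => (q.1 i, q.2 i)) (by fun_prop)
    refine PL_equiv (MeasurableEquiv.piFinSuccAbove (fun _ => X) 0)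
      (MeasurableEquiv.piFinSuccAbove (fun _ => K) 0)
      (measurePreserving_piFinSuccAbove (fun _ => μ) 0) (measurePreserving_piFinSuccAbove (fun _ => ν) 0) ?_ 
      (PL_prod he hm h1 (fun x k => by simp [h1]) h ih)
    intro x k
    rw [Fin.prod_univ_succ]
    rfl

lemma PL_real : PL (volume : Measure ℝ) (volume : Measure ℝ)
    (fun x k => Complex.exp (Complex.I * ((x * k : ℝ) : ℂ))) (ENNReal.ofReal (2 * Real.pi)) :=
  fun f hf => plancherel_R f hf

lemma torus_orth (lam : ℝ) (hl : 0 < lam) (j : ℤ) :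
    ∫ y in Set.Icc 0 (2 * Real.pi * lam), Complex.exp (Complex.I * ((y * (j / lam) : ℝ) : ℂ))
      = if j = 0 then ((2 * Real.pi * lam : ℝ) : ℂ) else 0 := by
  have hpos : 0 ≤ 2 * Real.pi * lam := by positivity
  rw [integral_Icc_eq_integral_Ioc, ← intervalIntegral.integral_of_le hpos]
  split_ifs with h
  · subst h; simp
  · have e : ∀ y : ℝ, Complex.exp (Complex.I * ((y * (j / lam) : ℝ) : ℂ)) 
        = Complex.exp ((Complex.I * (j / lam)) * (y : ℂ)) := by
      intro y; congr 1; push_cast; ring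
    simp_rw [e]
    have hl' : (lam : ℂ) ≠ 0 := by exact_mod_cast hl.ne'
    have hj' : (j : ℂ) ≠ 0 := by exact_mod_cast h
    rw [integral_exp_mul_complex]
    · have : Complex.I * (j / lam) * ((2 * Real.pi * lam : ℝ) : ℂ) = j * (2 * Real.pi * Complex.I) := by
        push_cast; field_simp
      rw [this, Complex.exp_int_mul_two_pi_mul_I]
      simp
    · simp [h, hl.ne']

lemma torus_finite (lam : ℝ) (hl : 0 < lam) (s : Finset ℤ) (f : ℤ → ℂ) :
    ∫⁻ y in Set.Icc 0 (2 * Real.pi * lam), 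
        ‖∑ j ∈ s, f j * Complex.exp (Complex.I * ((y * (j / lam) : ℝ) : ℂ))‖ₑ ^ 2
      = ENNReal.ofReal (2 * Real.pi * lam) * ∑ j ∈ s, ‖f j‖ₑ ^ 2 := by
  set F : ℝ → ℂ := fun y => ∑ j ∈ s, f j * Complex.exp (Complex.I * ((y * (j / lam) : ℝ) : ℂ)) with hF
  have hc : Continuous F := by fun_prop
  have e1 : ∀ y, ‖F y‖ₑ ^ 2 = ENNReal.ofReal (‖F y‖ ^ 2) := by
    intro y
    rw [ENNReal.ofReal_pow (norm_nonneg _), ofReal_norm]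
  have e2 : ∀ y : ℝ, ((‖F y‖ ^ 2 : ℝ) : ℂ) = ∑ j ∈ s, ∑ l ∈ s, (f j * (starRingEnd ℂ) (f l)) * 
      Complex.exp (Complex.I * ((y * (((j - l : ℤ) : ℝ) / lam) : ℝ) : ℂ)) := by
    intro y
    have : ((‖F y‖ ^ 2 : ℝ) : ℂ) = F y * (starRingEnd ℂ) (F y) := by
      rw [Complex.mul_conj, Complex.normSq_eq_norm_sq]
    rw [this]
    simp only [hF, map_sum, Finset.sum_mul_sum]
    refine Finset.sum_congr rfl fun j _ => Finset.sum_congr rfl fun l _ => ?_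
    have e3 : Complex.exp (Complex.I * ((y * (((j - l : ℤ) : ℝ) / lam) : ℝ) : ℂ)) =
      Complex.exp (Complex.I * ((y * (j / lam) : ℝ) : ℂ)) * (starRingEnd ℂ) (Complex.exp (Complex.I * ((y * (l / lam) : ℝ) : ℂ))) := by
      rw [← Complex.exp_conj, ← Complex.exp_add]
      congr 1
      simp only [map_mul, Complex.conj_I, Complex.conj_ofReal]
      push_cast
      ring
    rw [e3, map_mul]
    ring
  have hInt : ∫ y in Set.Icc 0 (2 * Real.pi * lam), ‖F y‖ ^ 2 = 2 * Real.pi * lam * ∑ j ∈ s, ‖f j‖ ^ 2 := by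
    have : ((∫ y in Set.Icc 0 (2 * Real.pi * lam), ‖F y‖ ^ 2 : ℝ) : ℂ) = ((2 * Real.pi * lam * ∑ j ∈ s, ‖f j‖ ^ 2 : ℝ) : ℂ) := by
      rw [← integral_complex_ofReal]
      simp_rw [e2]
      rw [integral_finsetSum]
      · rw [Complex.ofReal_mul, Complex.ofReal_sum, Finset.mul_sum]
        refine Finset.sum_congr rfl fun j hj => ?_
        rw [integral_finsetSum]
        · simp_rw [integral_const_mul, torus_orth lam hl, sub_eq_zero]
          simp [hj]
          rw [Complex.mul_conj, Complex.normSq_eq_norm_sq]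
          push_cast; ring
        · intro l _
          exact (Continuous.integrableOn_Icc (by fun_prop))
      · intro l _
        exact (Continuous.integrableOn_Icc (by fun_prop))
    exact_mod_cast this
  have := ofReal_integral_eq_lintegral_ofReal (μ := volume.restrict (Set.Icc 0 (2 * Real.pi * lam)))
    (f := fun y => ‖F y‖ ^ 2) (Continuous.integrableOn_Icc (by fun_prop)) (Filter.Eventually.of_forall fun y => by positivity)
  change ∫⁻ y in Set.Icc 0 (2 * Real.pi * lam), ‖F y‖ₑ ^ 2 = _
  simp_rw [e1]
  rw [← this, hInt, ENNReal.ofReal_mul (by positivity), ENNReal.ofReal_sum_of_nonneg (fun _ _ => by positivity)]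
  simp_rw [ENNReal.ofReal_pow (norm_nonneg _), ofReal_norm]

lemma PL_torus (lam : ℝ) (hl : 0 < lam) : PL (volume.restrict (Set.Icc 0 (2 * Real.pi * lam))) (Measure.count : Measure ℤ)
    (fun y j => Complex.exp (Complex.I * ((y * (j / lam) : ℝ) : ℂ))) (ENNReal.ofReal (2 * Real.pi * lam)) := by
  intro f hf
  by_cases hi : Integrable f (Measure.count : Measure ℤ)
  swap
  · have : ∀ y : ℝ, ∫ k : ℤ, f k * Complex.exp (Complex.I * ((y * (k / lam) : ℝ) : ℂ)) ∂Measure.count = 0 := by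
      intro x
      apply integral_undef
      rw [integrable_mul_unit]
      · exact hi
      · fun_prop
      · intro k; exact Complex.norm_exp_I_mul_ofReal _
    simp_rw [this]
    simp
  have hs : Summable fun j => ‖f j‖ := (integrable_count_iff.1 hi)
  have hE : ∀ y : ℝ, ∫ k : ℤ, f k * Complex.exp (Complex.I * ((y * (k / lam) : ℝ) : ℂ)) ∂Measure.count
     = ∑' k : ℤ, f k * Complex.exp (Complex.I * ((y * (k / lam) : ℝ) : ℂ)) := by
    intro y
    rw [integral_countable]
    · simp
    · rw [integrable_mul_unit]
      · exact hi
      · fun_prop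
      · intro k; exact Complex.norm_exp_I_mul_ofReal _
  simp_rw [hE]
  let s : ℕ → Finset ℤ := fun n => Finset.Icc (-n : ℤ) n
  have hsT : Filter.Tendsto s Filter.atTop Filter.atTop := by
    refine Filter.tendsto_atTop_finset_of_monotone ?_ ?_
    · intro a b hab x hx
      simp only [s, Finset.mem_Icc] at hx ⊢
      omega
    · intro x
      refine ⟨x.natAbs, ?_⟩
      simp only [s, Finset.mem_Icc]
      omega
  have hlim : ∀ y : ℝ, Filter.Tendsto (fun n => ‖∑ j ∈ s n, f j * Complex.exp (Complex.I * ((y * (j / lam) : ℝ) : ℂ))‖ₑ ^ 2)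
      Filter.atTop (nhds (‖∑' k : ℤ, f k * Complex.exp (Complex.I * ((y * (k / lam) : ℝ) : ℂ))‖ₑ ^ 2)) := by
    intro y
    have hsum : Summable fun k : ℤ => f k * Complex.exp (Complex.I * ((y * (k / lam) : ℝ) : ℂ)) := by
      apply Summable.of_norm
      simpa [Complex.norm_exp_I_mul_ofReal, -Complex.ofReal_mul, -Complex.ofReal_div] using hs
    have := (hsum.hasSum.comp hsT).enorm
    exact ENNReal.Tendsto.pow this
  calc _ = ∫⁻ y in Set.Icc 0 (2 * Real.pi * lam), Filter.liminf (fun n => ‖∑ j ∈ s n, f j * Complex.exp (Complex.I * ((y * (j / lam) : ℝ) : ℂ))‖ₑ ^ 2) Filter.atTop := by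
        congr 1; ext y; exact (hlim y).liminf_eq.symm
    _ ≤ Filter.liminf (fun n => ∫⁻ y in Set.Icc 0 (2 * Real.pi * lam), ‖∑ j ∈ s n, f j * Complex.exp (Complex.I * ((y * (j / lam) : ℝ) : ℂ))‖ₑ ^ 2) Filter.atTop := by
        apply lintegral_liminf_le
        intro n
        fun_prop
    _ ≤ _ := by
        apply Filter.liminf_le_of_le
        · exact ⟨0, by simp⟩
        · intro b hb
          obtain ⟨n, hn⟩ := hb.exists
          refine hn.trans ?_
          rw [torus_finite lam hl, lintegral_count]
          gcongr
          exact ENNReal.sum_le_tsum _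


lemma cs_set {K : Type*} [MeasurableSpace K] {ν : Measure K} (S : Set K) {u : K → ℝ≥0∞} (hu : AEMeasurable u (ν.restrict S)) :
    (∫⁻ k in S, u k ∂ν) ^ 2 ≤ ν S * ∫⁻ k in S, u k ^ 2 ∂ν := by
  have := ENNReal.lintegral_mul_le_Lp_mul_Lq (ν.restrict S) (p := 2) (q := 2) (Real.HolderConjugate.two_two)
    (f := fun _ => 1) (g := u) aemeasurable_const hu
  have h2 := pow_le_pow_left₀ (by simp) this 2
  rw [mul_pow] at h2
  simp only [← ENNReal.rpow_natCast, ← ENNReal.rpow_mul] at h2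
  simpa using h2

lemma quad1D (B : ℝ → ℂ) (hB : Measurable B) :
    ∫⁻ t : ℝ, ‖∫ r in Set.Ioi (0 : ℝ), ((r : ℂ) * B r) * Complex.exp (Complex.I * ((-(2 * t * r ^ 2) : ℝ) : ℂ))‖ₑ ^ 2
      ≤ ENNReal.ofReal (2 * Real.pi) * ∫⁻ r in Set.Ioi (0 : ℝ), ENNReal.ofReal r * ‖B r‖ₑ ^ 2 := by
  set A : ℝ → ℂ := fun u => (1 / 4 : ℂ) * B (Real.sqrt (-u / 2)) with hA
  have hAm : Measurable A := by
    apply Measurable.const_mul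
    exact hB.comp (by fun_prop)
  have hsq : ∀ r ∈ Set.Ioi (0 : ℝ), Real.sqrt (-(-(2 * r ^ 2)) / 2) = r := by
    intro r hr
    have : -(-(2 * r ^ 2)) / 2 = r ^ 2 := by ring
    rw [this, Real.sqrt_sq (le_of_lt hr)]
  have himg : (fun r : ℝ => -(2 * r ^ 2)) '' Set.Ioi 0 = Set.Iio 0 := by
    ext u
    simp only [Set.mem_image, Set.mem_Ioi, Set.mem_Iio]
    constructor
    · rintro ⟨r, hr, rfl⟩
      have : 0 < r ^ 2 := by positivity
      linarith
    · intro hu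
      refine ⟨Real.sqrt (-u / 2), Real.sqrt_pos.2 (by linarith), ?_⟩
      rw [Real.sq_sqrt (by linarith)]
      ring
  have hinj : Set.InjOn (fun r : ℝ => -(2 * r ^ 2)) (Set.Ioi 0) := by
    intro a ha b hb hab
    simp only at hab
    rw [← hsq a ha, ← hsq b hb, hab]
  have hder : ∀ r ∈ Set.Ioi (0 : ℝ), HasDerivWithinAt (fun r : ℝ => -(2 * r ^ 2)) (-(4 * r)) (Set.Ioi 0) r := by
    intro r _
    apply HasDerivAt.hasDerivWithinAt
    have := (((hasDerivAt_id r).pow 2).const_mul 2).neg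
    convert! this using 1
    simp; ring
  have h := PL_real ((Set.Iio 0).indicator A) (hAm.indicator measurableSet_Iio)
  have e1 : ∀ t : ℝ, ∫ k, (Set.Iio 0).indicator A k * Complex.exp (Complex.I * ((t * k : ℝ) : ℂ))
      = ∫ r in Set.Ioi (0 : ℝ), ((r : ℂ) * B r) * Complex.exp (Complex.I * ((-(2 * t * r ^ 2) : ℝ) : ℂ)) := by
    intro t
    have : ∀ k, (Set.Iio 0).indicator A k * Complex.exp (Complex.I * ((t * k : ℝ) : ℂ))
       = (Set.Iio 0).indicator (fun k => A k * Complex.exp (Complex.I * ((t * k : ℝ) : ℂ))) k := by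
      intro k
      by_cases hk : k ∈ Set.Iio (0 : ℝ) <;> simp [hk, Set.indicator]
    simp_rw [this]
    rw [integral_indicator measurableSet_Iio, ← himg, integral_image_eq_integral_abs_deriv_smul measurableSet_Ioi hder hinj]
    refine setIntegral_congr_fun measurableSet_Ioi fun r hr => ?_
    simp only [hA, hsq r hr]
    have hr' : (0:ℝ) < r := hr
    rw [abs_neg, abs_of_pos (by positivity)]
    rw [Complex.real_smul]
    have : t * -(2 * r ^ 2) = -(2 * t * r ^ 2) := by ring
    rw [this]
    push_cast
    ring
  have e2 : ∫⁻ k, ‖(Set.Iio 0).indicator A k‖ₑ ^ 2 ≤ ∫⁻ r in Set.Ioi (0 : ℝ), ENNReal.ofReal r * ‖B r‖ₑ ^ 2 := by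
    have : ∀ k, ‖(Set.Iio 0).indicator A k‖ₑ ^ 2 = (Set.Iio 0).indicator (fun k => ‖A k‖ₑ ^ 2) k := by
      intro k
      by_cases hk : k ∈ Set.Iio (0 : ℝ) <;> simp [hk, Set.indicator]
    simp_rw [this]
    rw [lintegral_indicator measurableSet_Iio, ← himg, lintegral_image_eq_lintegral_abs_deriv_mul measurableSet_Ioi hder hinj]
    refine setLIntegral_mono' measurableSet_Ioi fun r hr => ?_
    simp only [hA, hsq r hr]
    have hr' : (0:ℝ) < r := hr
    rw [abs_neg, abs_of_pos (by positivity), enorm_mul, mul_pow, ← mul_assoc]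
    gcongr
    rw [← ofReal_norm, ← ENNReal.ofReal_pow (norm_nonneg _), ← ENNReal.ofReal_mul (by positivity)]
    apply ENNReal.ofReal_le_ofReal
    norm_num
    linarith
  simp_rw [e1] at h
  exact h.trans (by gcongr)

lemma polar_bound (f : ℝ × ℝ → ℂ) (hf : Measurable f) :
    ∫⁻ t : ℝ, ‖∫ η, f η * Complex.exp (Complex.I * ((-(2 * t * (η.1 ^ 2 + η.2 ^ 2)) : ℝ) : ℂ))‖ₑ ^ 2
      ≤ ENNReal.ofReal (2 * Real.pi) ^ 2 * ∫⁻ η, ‖f η‖ₑ ^ 2 := by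
  by_cases hi : Integrable f
  swap
  · have : ∀ t : ℝ, ∫ η, f η * Complex.exp (Complex.I * ((-(2 * t * (η.1 ^ 2 + η.2 ^ 2)) : ℝ) : ℂ)) = 0 := by
      intro x
      apply integral_undef
      rw [integrable_mul_unit]
      · exact hi
      · fun_prop
      · intro k; exact Complex.norm_exp_I_mul_ofReal _
    simp_rw [this]
    simp
  have hpm : Measurable fun p : ℝ × ℝ => f (p.1 * Real.cos p.2, p.1 * Real.sin p.2) := hf.comp (by fun_prop)
  have htgt : polarCoord.target = Set.Ioi (0 : ℝ) ×ˢ Set.Ioo (-Real.pi) Real.pi := rfl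
  have hsym : ∀ p : ℝ × ℝ, polarCoord.symm p = (p.1 * Real.cos p.2, p.1 * Real.sin p.2) := fun p => rfl
  set B : ℝ → ℂ := fun r => ∫ θ in Set.Ioo (-Real.pi) Real.pi, f (r * Real.cos θ, r * Real.sin θ) with hBdef
  have hB : Measurable B := measurable_param hpm
  have hvol : (volume : Measure (ℝ × ℝ)).restrict (Set.Ioi (0 : ℝ) ×ˢ Set.Ioo (-Real.pi) Real.pi)
     = (volume.restrict (Set.Ioi (0 : ℝ))).prod (volume.restrict (Set.Ioo (-Real.pi) Real.pi)) := by
    rw [Measure.prod_restrict]; rfl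
  have hInt : Integrable (fun p : ℝ × ℝ => (p.1 : ℂ) * f (p.1 * Real.cos p.2, p.1 * Real.sin p.2))
      ((volume.restrict (Set.Ioi (0 : ℝ))).prod (volume.restrict (Set.Ioo (-Real.pi) Real.pi))) := by
    refine ⟨?_, ?_⟩
    · exact ((by fun_prop : Measurable fun p : ℝ × ℝ => (p.1 : ℂ)).mul hpm).aestronglyMeasurable
    · have h2 := hi.2
      rw [hasFiniteIntegral_iff_enorm] at h2 ⊢
      rw [← lintegral_comp_polarCoord_symm, htgt, hvol] at h2
      refine lt_of_le_of_lt (le_of_eq ?_) h2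
      rw [← hvol]
      refine setLIntegral_congr_fun (measurableSet_Ioi.prod measurableSet_Ioo) fun p hp => ?_
      have : (0 : ℝ) < p.1 := hp.1
      simp only [enorm_mul, hsym, smul_eq_mul]
      congr 1
      rw [← ofReal_norm]
      simp [abs_of_pos this]
  have e1 : ∀ t : ℝ, ∫ η, f η * Complex.exp (Complex.I * ((-(2 * t * (η.1 ^ 2 + η.2 ^ 2)) : ℝ) : ℂ))
     = ∫ r in Set.Ioi (0 : ℝ), ((r : ℂ) * B r) * Complex.exp (Complex.I * ((-(2 * t * r ^ 2) : ℝ) : ℂ)) := by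
    intro t
    rw [← integral_comp_polarCoord_symm, htgt, hvol]
    have : ∀ p : ℝ × ℝ, p.1 • (f (polarCoord.symm p) * Complex.exp (Complex.I * ((-(2 * t * ((polarCoord.symm p).1 ^ 2 + (polarCoord.symm p).2 ^ 2)) : ℝ) : ℂ)))
       = ((p.1 : ℂ) * f (p.1 * Real.cos p.2, p.1 * Real.sin p.2)) * Complex.exp (Complex.I * ((-(2 * t * p.1 ^ 2) : ℝ) : ℂ)) := by
      intro p
      rw [hsym, Complex.real_smul]
      have : (p.1 * Real.cos p.2) ^ 2 + (p.1 * Real.sin p.2) ^ 2 = p.1 ^ 2 := by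
        have := Real.cos_sq_add_sin_sq p.2
        linear_combination p.1 ^ 2 * this
      simp only [this]
      ring
    simp_rw [this]
    rw [integral_prod]
    · congr 1
      ext r
      dsimp only
      rw [integral_mul_const, integral_const_mul]
    · rw [integrable_mul_unit]
      · exact hInt
      · fun_prop
      · intro k; exact Complex.norm_exp_I_mul_ofReal _
  simp_rw [e1]
  refine (quad1D B hB).trans ?_
  rw [pow_two, mul_assoc]
  gcongr
  have hB2 : ∀ r, ‖B r‖ₑ ^ 2 ≤ ENNReal.ofReal (2 * Real.pi) * ∫⁻ θ in Set.Ioo (-Real.pi) Real.pi, ‖f (r * Real.cos θ, r * Real.sin θ)‖ₑ ^ 2 := by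
    intro r
    have hm : Measurable fun θ : ℝ => f (r * Real.cos θ, r * Real.sin θ) := hf.comp (by fun_prop)
    calc ‖B r‖ₑ ^ 2 ≤ (∫⁻ θ in Set.Ioo (-Real.pi) Real.pi, ‖f (r * Real.cos θ, r * Real.sin θ)‖ₑ) ^ 2 := by
          gcongr; exact enorm_integral_le_lintegral_enorm _
      _ ≤ volume (Set.Ioo (-Real.pi) Real.pi) * _ := cs_set _ hm.enorm.aemeasurable
      _ = _ := by
        rw [Real.volume_Ioo]; congr 2; ring
  calc ∫⁻ r in Set.Ioi (0 : ℝ), ENNReal.ofReal r * ‖B r‖ₑ ^ 2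
     ≤ ∫⁻ r in Set.Ioi (0 : ℝ), ENNReal.ofReal (2 * Real.pi) * ∫⁻ θ in Set.Ioo (-Real.pi) Real.pi, ENNReal.ofReal r * ‖f (r * Real.cos θ, r * Real.sin θ)‖ₑ ^ 2 := by
        apply lintegral_mono
        intro r
        have hm : Measurable fun θ : ℝ => f (r * Real.cos θ, r * Real.sin θ) := hf.comp (by fun_prop)
        simp only
        rw [lintegral_const_mul _ (hm.enorm.pow_const 2), mul_left_comm]
        gcongr
        exact hB2 r
    _ = ENNReal.ofReal (2 * Real.pi) * ∫⁻ p, ENNReal.ofReal p.1 * ‖f (p.1 * Real.cos p.2, p.1 * Real.sin p.2)‖ₑ ^ 2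
       ∂((volume.restrict (Set.Ioi (0 : ℝ))).prod (volume.restrict (Set.Ioo (-Real.pi) Real.pi))) := by
        have hmm : Measurable fun p : ℝ × ℝ => ENNReal.ofReal p.1 * ‖f (p.1 * Real.cos p.2, p.1 * Real.sin p.2)‖ₑ ^ 2 :=
          (by fun_prop : Measurable fun p : ℝ × ℝ => ENNReal.ofReal p.1).mul (hpm.enorm.pow_const 2)
        rw [lintegral_const_mul, lintegral_prod]
        · exact hmm.aemeasurable
        · exact hmm.lintegral_prod_right'
    _ = ENNReal.ofReal (2 * Real.pi) * ∫⁻ η, ‖f η‖ₑ ^ 2 := by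
        rw [← lintegral_comp_polarCoord_symm, htgt, hvol]
        rfl

abbrev R2 := ℝ × ℝ

/-- (ξ, η) ↦ (ξ/2 + η, ξ/2 - η) -/
def shear : (R2 × R2) ≃ᵐ (R2 × R2) where
  toFun p := ((1 / 2 : ℝ) • p.1 + p.2, (1 / 2 : ℝ) • p.1 - p.2)
  invFun p := (p.1 + p.2, (1 / 2 : ℝ) • (p.1 - p.2))
  left_inv p := by
    ext <;> simp <;> ring
  right_inv p := by
    ext <;> simp <;> ring
  measurable_toFun := by
    change Measurable fun p : R2 × R2 => ((1 / 2 : ℝ) • p.1 + p.2, (1 / 2 : ℝ) • p.1 - p.2)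
    fun_prop
  measurable_invFun := by
    change Measurable fun p : R2 × R2 => (p.1 + p.2, (1 / 2 : ℝ) • (p.1 - p.2))
    fun_prop

lemma shear_apply (p : R2 × R2) : shear p = ((1 / 2 : ℝ) • p.1 + p.2, (1 / 2 : ℝ) • p.1 - p.2) := rfl

lemma shear_mp : MeasurePreserving shear ((volume : Measure R2).prod volume) ((volume : Measure R2).prod volume) := by
  have a1 : MeasurePreserving (fun p : R2 × R2 => (p.1, (1 / 2 : ℝ) • p.1 + p.2)) ((volume : Measure R2).prod volume) ((volume : Measure R2).prod volume) := by
    refine (MeasurePreserving.id _).skew_product (g := fun a c => (1 / 2 : ℝ) • a + c) (by fun_prop) ?_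
    exact Filter.Eventually.of_forall fun a => map_add_left_eq_self _ _
  have a2 : MeasurePreserving (fun p : R2 × R2 => (p.1, p.2 - p.1)) ((volume : Measure R2).prod volume) ((volume : Measure R2).prod volume) := by
    refine (MeasurePreserving.id _).skew_product (g := fun a c => c - a) (by fun_prop) ?_
    exact Filter.Eventually.of_forall fun a => map_sub_right_eq_self _ _
  have := a2.comp (Measure.measurePreserving_swap.comp a1)
  convert! this using 1
  ext p <;> simp [shear_apply] <;> ring

def kern2 (a : ℝ × R2) (k : R2) : ℂ :=
  Complex.exp (Complex.I * ((a.2.1 * k.1 + a.2.2 * k.2 - a.1 * (k.1 ^ 2 + k.2 ^ 2) : ℝ) : ℂ))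

lemma kern2_meas : Measurable (Function.uncurry kern2) := by
  unfold Function.uncurry kern2
  fun_prop

lemma kern2_norm (a k) : ‖kern2 a k‖ = 1 := Complex.norm_exp_I_mul_ofReal _

lemma strichartz2 (g : R2 → ℂ) (hg : Measurable g) :
    ∫⁻ a : ℝ × R2, ‖∫ k, g k * kern2 a k‖ₑ ^ 4
      ≤ ENNReal.ofReal (2 * Real.pi) ^ 4 * (∫⁻ k, ‖g k‖ₑ ^ 2) ^ 2 := by
  have hkm : ∀ a, Measurable (kern2 a) := fun a => kern2_meas.comp (measurable_const.prodMk measurable_id)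
  by_cases hi : Integrable g
  swap
  · have : ∀ a, ∫ k, g k * kern2 a k = 0 := by
      intro x
      apply integral_undef
      rw [integrable_mul_unit (hkm _) (kern2_norm _)]
      exact hi
    simp_rw [this]
    simp
  set F : R2 × R2 → ℂ := fun p => g (shear p).1 * g (shear p).2 with hF
  have hFm : Measurable F := (hg.comp (measurable_fst.comp shear.measurable)).mul (hg.comp (measurable_snd.comp shear.measurable))
  set c : ℝ → R2 → ℂ := fun t ξ => ∫ η, F (ξ, η) * Complex.exp (Complex.I * ((-(2 * t * (η.1 ^ 2 + η.2 ^ 2)) : ℝ) : ℂ)) with hc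
  have hcm : Measurable (Function.uncurry c) := by
    apply measurable_param (X := ℝ × R2) (F := fun p (η : R2) => F (p.2, η) * Complex.exp (Complex.I * ((-(2 * p.1 * (η.1 ^ 2 + η.2 ^ 2)) : ℝ) : ℂ)))
    apply Measurable.mul
    · exact hFm.comp (f := fun q : (ℝ × R2) × R2 => (q.1.2, q.2)) (by fun_prop)
    · fun_prop
  set b : ℝ → R2 → ℂ := fun t ξ => Complex.exp (Complex.I * ((-(t * (ξ.1 ^ 2 + ξ.2 ^ 2) / 2) : ℝ) : ℂ)) * c t ξ with hb
  have hbm : ∀ t, Measurable (b t) := by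
    intro t
    apply Measurable.mul
    · fun_prop
    · exact hcm.comp (f := fun ξ : R2 => (t, ξ)) (by fun_prop)
  have hbn : ∀ t ξ, ‖b t ξ‖ₑ = ‖c t ξ‖ₑ := by
    intro t ξ
    rw [hb]; simp only
    rw [enorm_mul, enorm_unit (Complex.norm_exp_I_mul_ofReal _), one_mul]
  have sq : ∀ t x, (∫ k, g k * kern2 (t, x) k) ^ 2 = 
     ∫ ξ, b t ξ * (Complex.exp (Complex.I * ((x.1 * ξ.1 : ℝ) : ℂ)) * Complex.exp (Complex.I * ((x.2 * ξ.2 : ℝ) : ℂ))) := by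
    intro t x
    have hI : Integrable (fun k => g k * kern2 (t, x) k) := (integrable_mul_unit (hkm _) (kern2_norm _)).2 hi
    rw [pow_two, ← integral_prod_mul (fun k => g k * kern2 (t, x) k) (fun k => g k * kern2 (t, x) k),
      ← shear_mp.integral_comp shear.measurableEmbedding]
    rw [integral_prod]
    · congr 1
      ext ξ
      rw [hb]; simp only
      rw [mul_right_comm, ← integral_const_mul]
      congr 1
      ext η
      have : kern2 (t, x) (shear (ξ, η)).1 * kern2 (t, x) (shear (ξ, η)).2 = 
         Complex.exp (Complex.I * ((-(t * (ξ.1 ^ 2 + ξ.2 ^ 2) / 2) : ℝ) : ℂ)) * 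
         (Complex.exp (Complex.I * ((x.1 * ξ.1 : ℝ) : ℂ)) * Complex.exp (Complex.I * ((x.2 * ξ.2 : ℝ) : ℂ)))
         * Complex.exp (Complex.I * ((-(2 * t * (η.1 ^ 2 + η.2 ^ 2)) : ℝ) : ℂ)) := by
        unfold kern2
        simp only [← Complex.exp_add, shear_apply]
        congr 1
        simp
        ring
      calc _ = F (ξ, η) * (kern2 (t, x) (shear (ξ, η)).1 * kern2 (t, x) (shear (ξ, η)).2) := by
            simp only [hF]; ring
        _ = _ := by rw [this]; ring
    · exact (shear_mp.integrable_comp_emb shear.measurableEmbedding).2 (hI.mul_prod hI)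
  have hPL := PL_prod (by unfold Function.uncurry; fun_prop) (by unfold Function.uncurry; fun_prop)
     (fun x k => Complex.norm_exp_I_mul_ofReal _) (fun x k => Complex.norm_exp_I_mul_ofReal _) PL_real PL_real
  have hGm : Measurable fun a : ℝ × R2 => ‖∫ k, g k * kern2 a k‖ₑ ^ 4 := by
    apply Measurable.pow_const
    apply Measurable.enorm
    apply measurable_param
    exact (hg.comp measurable_snd).mul kern2_meas
  calc ∫⁻ a : ℝ × R2, ‖∫ k, g k * kern2 a k‖ₑ ^ 4
      = ∫⁻ t, ∫⁻ x : R2, ‖∫ k, g k * kern2 (t, x) k‖ₑ ^ 4 := by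
        exact lintegral_prod _ hGm.aemeasurable
    _ ≤ ∫⁻ t, ENNReal.ofReal (2 * Real.pi) ^ 2 * ∫⁻ ξ, ‖c t ξ‖ₑ ^ 2 := by
        apply lintegral_mono
        intro t
        have := hPL (b t) (hbm t)
        simp only [hbn] at this
        rw [pow_two (ENNReal.ofReal _)]
        refine le_trans (le_of_eq ?_) this
        refine lintegral_congr fun x => ?_
        refine Eq.trans ?_ (congrArg (fun z => ‖z‖ₑ ^ 2) (sq t x))
        rw [← enorm_pow, ← enorm_pow, ← pow_mul]
    _ = ENNReal.ofReal (2 * Real.pi) ^ 2 * ∫⁻ ξ, ∫⁻ t, ‖c t ξ‖ₑ ^ 2 := by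
        rw [lintegral_const_mul, lintegral_lintegral_swap]
        · exact (hcm.enorm.pow_const 2).aemeasurable
        · exact (hcm.enorm.pow_const 2).lintegral_prod_right'
    _ ≤ ENNReal.ofReal (2 * Real.pi) ^ 2 * ∫⁻ ξ, ENNReal.ofReal (2 * Real.pi) ^ 2 * ∫⁻ η, ‖F (ξ, η)‖ₑ ^ 2 := by
        gcongr with ξ
        exact polar_bound (fun η => F (ξ, η)) (hFm.comp (by fun_prop))
    _ = ENNReal.ofReal (2 * Real.pi) ^ 4 * ∫⁻ p, ‖F p‖ₑ ^ 2 ∂((volume : Measure R2).prod volume) := by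
        rw [lintegral_const_mul, lintegral_prod, ← mul_assoc]
        · ring
        · exact (hFm.enorm.pow_const 2).aemeasurable
        · exact (hFm.enorm.pow_const 2).lintegral_prod_right'
    _ = _ := by
        congr 1
        have hm := (hg.enorm.pow_const 2)
        rw [pow_two (∫⁻ k, _), ← lintegral_prod_mul hm.aemeasurable hm.aemeasurable]
        rw [← shear_mp.lintegral_comp_emb shear.measurableEmbedding
          (f := fun z : R2 × R2 => ‖g z.1‖ₑ ^ 2 * ‖g z.2‖ₑ ^ 2)]
        simp only [hF, enorm_mul, mul_pow]


lemma cs_two {A : Type*} [MeasurableSpace A] {α : Measure A} {u v : A → ℝ≥0∞} 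
    (hu : AEMeasurable u α) (hv : AEMeasurable v α) {a b C : ℝ≥0∞}
    (h1 : ∫⁻ x, u x ^ 2 ∂α ≤ C * a ^ 2) (h2 : ∫⁻ x, v x ^ 2 ∂α ≤ C * b ^ 2) :
    ∫⁻ x, u x * v x ∂α ≤ C * (a * b) := by
  have := ENNReal.lintegral_mul_le_Lp_mul_Lq α (p := 2) (q := 2) (Real.HolderConjugate.two_two) hu hv
  simp only [Pi.mul_apply, ENNReal.rpow_two] at this
  refine this.trans ?_
  calc _ ≤ (C * a ^ 2) ^ (1 / 2 : ℝ) * (C * b ^ 2) ^ (1 / 2 : ℝ) := by gcongr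
    _ = C * (a * b) := by
      rw [← ENNReal.mul_rpow_of_nonneg _ _ (by norm_num)]
      have : C * a ^ 2 * (C * b ^ 2) = (C * (a * b)) ^ (2 : ℝ) := by
        rw [ENNReal.rpow_two]; ring
      rw [this, ← ENNReal.rpow_mul]
      norm_num

lemma L4_prod {A K1 X K2 : Type*} [MeasurableSpace A] [MeasurableSpace K1]
    [MeasurableSpace X] [MeasurableSpace K2] {α : Measure A} {ν1 : Measure K1}
    {μ : Measure X} {ν2 : Measure K2} [SFinite α] [SFinite ν1] [SFinite μ] [SFinite ν2]
    {e1 : A → K1 → ℂ} {φ : A → K2 → ℂ} {e2 : X → K2 → ℂ} {C1 C2 : ℝ≥0∞}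
    (he1 : Measurable (Function.uncurry e1)) (hφ : Measurable (Function.uncurry φ))
    (he2 : Measurable (Function.uncurry e2))
    (n1 : ∀ x k, ‖e1 x k‖ = 1) (nφ : ∀ x k, ‖φ x k‖ = 1) (n2 : ∀ x k, ‖e2 x k‖ = 1)
    (h1 : ∀ f : K1 → ℂ, Measurable f → ∫⁻ a, ‖∫ k, f k * e1 a k ∂ν1‖ₑ ^ 4 ∂α ≤ C1 * (∫⁻ k, ‖f k‖ₑ ^ 2 ∂ν1) ^ 2)
    (h2 : PL μ ν2 e2 C2) (S : Set K2) (f : K1 × K2 → ℂ) (hf : Measurable f)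
    (hS : ∀ k, f k ≠ 0 → k.2 ∈ S) :
    ∫⁻ a, ∫⁻ x, ‖∫ k, f k * (e1 a k.1 * (φ a k.2 * e2 x k.2)) ∂(ν1.prod ν2)‖ₑ ^ 4 ∂μ ∂α
      ≤ ν2 S * C2 * (C1 * (∫⁻ k, ‖f k‖ₑ ^ 2 ∂(ν1.prod ν2)) ^ 2) := by
  have hm1 : ∀ a, Measurable (e1 a) := fun a => he1.comp (measurable_const.prodMk measurable_id)
  have hmφ : ∀ a, Measurable (φ a) := fun a => hφ.comp (measurable_const.prodMk measurable_id)
  have hm2 : ∀ a, Measurable (e2 a) := fun a => he2.comp (measurable_const.prodMk measurable_id)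
  have hEi : ∀ a x, Integrable (fun k : K1 × K2 => f k * (e1 a k.1 * (φ a k.2 * e2 x k.2))) (ν1.prod ν2) ↔ Integrable f (ν1.prod ν2) := by
    intro a x
    apply integrable_mul_unit
    · exact ((hm1 a).comp measurable_fst).mul (((hmφ a).comp measurable_snd).mul ((hm2 x).comp measurable_snd))
    · intro k; simp [n1, nφ, n2]
  by_cases hi : Integrable f (ν1.prod ν2)
  swap
  · have : ∀ a x, ∫ k, f k * (e1 a k.1 * (φ a k.2 * e2 x k.2)) ∂(ν1.prod ν2) = 0 := by
      intro a x
      exact integral_undef (fun h => hi ((hEi a x).1 h))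
    simp_rw [this]
    simp
  set G : A → K2 → ℂ := fun a k2 => ∫ k1, f (k1, k2) * e1 a k1 ∂ν1 with hG
  have hGm : Measurable (Function.uncurry G) := by
    apply measurable_param (X := A × K2) (F := fun p k1 => f (k1, p.2) * e1 p.1 k1)
    apply Measurable.mul
    · exact hf.comp (f := fun q : (A × K2) × K1 => (q.2, q.1.2)) (by fun_prop)
    · exact he1.comp (f := fun q : (A × K2) × K1 => (q.1.1, q.2)) (by fun_prop)
  have hGa : ∀ a, Measurable (G a) := fun a => hGm.comp (measurable_const.prodMk measurable_id)
  have hG0 : ∀ a k2, k2 ∉ S → G a k2 = 0 := by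
    intro a k2 hk
    have : ∀ k1, f (k1, k2) = 0 := by
      intro k1
      by_contra h
      exact hk (hS _ h)
    simp [hG, this]
  have hu : ∀ a x, ∫ k, f k * (e1 a k.1 * (φ a k.2 * e2 x k.2)) ∂(ν1.prod ν2)
      = ∫ k2, (φ a k2 * G a k2) * e2 x k2 ∂ν2 := by
    intro a x
    rw [integral_prod_symm _ ((hEi a x).2 hi)]
    congr 1
    ext k2
    rw [mul_right_comm, ← integral_const_mul]
    congr 1
    ext k1
    ring
  have hn : ∀ a k2, ‖φ a k2 * G a k2‖ₑ = ‖G a k2‖ₑ := by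
    intro a k2
    rw [enorm_mul, enorm_unit (nφ a k2), one_mul]
  set J : A → ℝ≥0∞ := fun a => ∫⁻ k2, ‖G a k2‖ₑ ^ 2 ∂ν2 with hJ
  have hsup : ∀ a x, ‖∫ k2, (φ a k2 * G a k2) * e2 x k2 ∂ν2‖ₑ ^ 2 ≤ ν2 S * J a := by
    intro a x
    have : ∫⁻ k2, ‖G a k2‖ₑ ∂ν2 = ∫⁻ k2 in S, ‖G a k2‖ₑ ∂ν2 := by
      refine (setLIntegral_eq_of_support_subset ?_).symm
      intro k2 hk
      by_contra h
      apply hk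
      simp [hG0 a k2 h]
    calc ‖∫ k2, (φ a k2 * G a k2) * e2 x k2 ∂ν2‖ₑ ^ 2 
        ≤ (∫⁻ k2, ‖(φ a k2 * G a k2) * e2 x k2‖ₑ ∂ν2) ^ 2 := by
          gcongr; exact enorm_integral_le_lintegral_enorm _
      _ = (∫⁻ k2 in S, ‖G a k2‖ₑ ∂ν2) ^ 2 := by
          rw [← this]
          congr 2
          ext k2
          rw [enorm_mul, hn, enorm_unit (n2 _ _), mul_one]
      _ ≤ ν2 S * ∫⁻ k2 in S, ‖G a k2‖ₑ ^ 2 ∂ν2 := cs_set _ (hGa a).enorm.aemeasurable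
      _ ≤ _ := by
          gcongr
          exact setLIntegral_le_lintegral _ _
  have hx : ∀ a, ∫⁻ x, ‖∫ k, f k * (e1 a k.1 * (φ a k.2 * e2 x k.2)) ∂(ν1.prod ν2)‖ₑ ^ 4 ∂μ ≤ ν2 S * C2 * J a ^ 2 := by
    intro a
    simp_rw [hu]
    have hbm : Measurable fun k2 => φ a k2 * G a k2 := (hmφ a).mul (hGa a)
    have hPm : Measurable fun x => ‖∫ k2, (φ a k2 * G a k2) * e2 x k2 ∂ν2‖ₑ ^ 2 := by
      apply Measurable.pow_const
      apply Measurable.enorm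
      apply measurable_param
      exact (hbm.comp measurable_snd).mul he2
    calc ∫⁻ x, ‖∫ k2, (φ a k2 * G a k2) * e2 x k2 ∂ν2‖ₑ ^ 4 ∂μ
        ≤ ∫⁻ x, (ν2 S * J a) * ‖∫ k2, (φ a k2 * G a k2) * e2 x k2 ∂ν2‖ₑ ^ 2 ∂μ := by
          apply lintegral_mono
          intro x
          simp only
          have e : ∀ z : ℝ≥0∞, z ^ 4 = z ^ 2 * z ^ 2 := fun z => by ring
          rw [e]
          gcongr
          exact hsup a x
      _ = (ν2 S * J a) * ∫⁻ x, ‖∫ k2, (φ a k2 * G a k2) * e2 x k2 ∂ν2‖ₑ ^ 2 ∂μ := lintegral_const_mul _ hPm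
      _ ≤ (ν2 S * J a) * (C2 * J a) := by
          gcongr
          refine (h2 _ hbm).trans (le_of_eq ?_)
          simp only [hn, hJ]
      _ = _ := by ring
  have hJm : Measurable J := (hGm.enorm.pow_const 2).lintegral_prod_right'
  refine (lintegral_mono hx).trans ?_
  rw [lintegral_const_mul _ (hJm.pow_const 2)]
  gcongr
  have m3 : Measurable fun q : (A × K2) × K2 => ‖G q.1.1 q.1.2‖ₑ ^ 2 * ‖G q.1.1 q.2‖ₑ ^ 2 := by
    apply Measurable.fun_mul
    · exact (hGm.enorm.pow_const 2).comp (f := fun q : (A × K2) × K2 => (q.1.1, q.1.2)) (by fun_prop)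
    · exact (hGm.enorm.pow_const 2).comp (f := fun q : (A × K2) × K2 => (q.1.1, q.2)) (by fun_prop)
  have m4 : ∀ k2, Measurable fun q : A × K2 => ‖G q.1 k2‖ₑ ^ 2 * ‖G q.1 q.2‖ₑ ^ 2 := by
    intro k2
    exact m3.comp (f := fun q : A × K2 => ((q.1, k2), q.2)) (by fun_prop)
  have hGk : ∀ k, Measurable fun a => ‖G a k‖ₑ ^ 2 := fun k =>
    (hGm.enorm.pow_const 2).comp (f := fun a : A => (a, k)) (by fun_prop)
  have hfs : Measurable fun k2 => ∫⁻ k1, ‖f (k1, k2)‖ₑ ^ 2 ∂ν1 := (hf.enorm.pow_const 2).lintegral_prod_left'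
  have h4 : ∀ k, ∫⁻ a, (‖G a k‖ₑ ^ 2) ^ 2 ∂α ≤ C1 * (∫⁻ k1, ‖f (k1, k)‖ₑ ^ 2 ∂ν1) ^ 2 := by
    intro k
    have := h1 (fun k1 => f (k1, k)) (hf.comp (by fun_prop))
    simpa only [← pow_mul] using this
  calc ∫⁻ a, J a ^ 2 ∂α = ∫⁻ a, ∫⁻ k, ∫⁻ l, ‖G a k‖ₑ ^ 2 * ‖G a l‖ₑ ^ 2 ∂ν2 ∂ν2 ∂α := by
        refine lintegral_congr fun a => ?_
        have hm := (hGa a).enorm.pow_const 2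
        simp_rw [lintegral_const_mul _ hm]
        rw [lintegral_mul_const _ hm, pow_two]
    _ = ∫⁻ k, ∫⁻ a, ∫⁻ l, ‖G a k‖ₑ ^ 2 * ‖G a l‖ₑ ^ 2 ∂ν2 ∂α ∂ν2 := by
        rw [lintegral_lintegral_swap]
        exact m3.lintegral_prod_right'.aemeasurable
    _ = ∫⁻ k, ∫⁻ l, ∫⁻ a, ‖G a k‖ₑ ^ 2 * ‖G a l‖ₑ ^ 2 ∂α ∂ν2 ∂ν2 := by
        refine lintegral_congr fun k => ?_
        rw [lintegral_lintegral_swap]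
        exact (m4 k).aemeasurable
    _ ≤ ∫⁻ k, ∫⁻ l, C1 * ((∫⁻ k1, ‖f (k1, k)‖ₑ ^ 2 ∂ν1) * (∫⁻ k1, ‖f (k1, l)‖ₑ ^ 2 ∂ν1)) ∂ν2 ∂ν2 := by
        refine lintegral_mono fun k => lintegral_mono fun l => ?_
        exact cs_two (hGk k).aemeasurable (hGk l).aemeasurable (h4 k) (h4 l)
    _ = C1 * (∫⁻ k, ‖f k‖ₑ ^ 2 ∂(ν1.prod ν2)) ^ 2 := by
        rw [lintegral_prod_symm _ (hf.enorm.pow_const 2).aemeasurable]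
        simp_rw [← mul_assoc, lintegral_const_mul _ hfs]
        rw [lintegral_mul_const, lintegral_const_mul _ hfs]
        · ring
        · exact hfs.const_mul _


lemma pi_count (n : ℕ) : (Measure.pi fun _ : Fin n => (Measure.count : Measure ℤ)) = Measure.count := by
  refine Measure.ext_of_singleton fun j => ?_
  rw [Measure.pi_singleton]
  simp

/-- the phase -/
def ph (lam : ℝ) {m n : ℕ} (t : ℝ) (x : Fin m → ℝ) (y : Fin n → ℝ) (k : (Fin m → ℝ) × (Fin n → ℤ)) : ℂ :=
  Complex.exp (Complex.I *
      ((((∑ i, x i * k.1 i) + ∑ i, y i * ((k.2 i : ℝ) / lam))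
        - t * ((∑ i, (k.1 i) ^ 2) + ∑ i, ((k.2 i : ℝ) / lam) ^ 2) : ℝ) : ℂ))

/-- the spatial character -/
def chr (lam : ℝ) {m n : ℕ} (x : (Fin m → ℝ) × (Fin n → ℝ)) (k : (Fin m → ℝ) × (Fin n → ℤ)) : ℂ :=
  (∏ i, Complex.exp (Complex.I * ((x.1 i * k.1 i : ℝ) : ℂ))) * 
  (∏ i, Complex.exp (Complex.I * ((x.2 i * (k.2 i / lam) : ℝ) : ℂ)))

def modu (lam : ℝ) {m n : ℕ} (t : ℝ) (k : (Fin m → ℝ) × (Fin n → ℤ)) : ℂ :=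
  Complex.exp (Complex.I * ((- t * ((∑ i, (k.1 i) ^ 2) + ∑ i, ((k.2 i : ℝ) / lam) ^ 2) : ℝ) : ℂ))

lemma ph_norm (lam : ℝ) {m n : ℕ} (t : ℝ) (x : Fin m → ℝ) (y : Fin n → ℝ) (k) : ‖ph lam t x y k‖ = 1 :=
  Complex.norm_exp_I_mul_ofReal _

lemma modu_norm (lam : ℝ) {m n : ℕ} (t : ℝ) (k : (Fin m → ℝ) × (Fin n → ℤ)) : ‖modu lam t k‖ = 1 :=
  Complex.norm_exp_I_mul_ofReal _

lemma chr_eq (lam : ℝ) {m n : ℕ} (x : (Fin m → ℝ) × (Fin n → ℝ)) (k : (Fin m → ℝ) × (Fin n → ℤ)) :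
    chr lam x k = Complex.exp (Complex.I * (((∑ i, x.1 i * k.1 i) + ∑ i, x.2 i * ((k.2 i : ℝ) / lam) : ℝ) : ℂ)) := by
  unfold chr
  rw [← Complex.exp_sum, ← Complex.exp_sum, ← Complex.exp_add]
  congr 1
  push_cast
  rw [← Finset.mul_sum, ← Finset.mul_sum]
  ring

lemma chr_norm (lam : ℝ) {m n : ℕ} (x : (Fin m → ℝ) × (Fin n → ℝ)) (k : (Fin m → ℝ) × (Fin n → ℤ)) : ‖chr lam x k‖ = 1 := by
  rw [chr_eq]
  exact Complex.norm_exp_I_mul_ofReal _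

lemma ph_eq (lam : ℝ) {m n : ℕ} (t : ℝ) (x : Fin m → ℝ) (y : Fin n → ℝ) (k) :
    ph lam t x y k = modu lam t k * chr lam (x, y) k := by
  rw [chr_eq]
  unfold ph modu
  rw [← Complex.exp_add]
  congr 1
  push_cast
  ring

lemma ph_meas (lam : ℝ) {m n : ℕ} : Measurable fun q : (ℝ × (Fin m → ℝ) × (Fin n → ℝ)) × ((Fin m → ℝ) × (Fin n → ℤ)) =>
    ph lam q.1.1 q.1.2.1 q.1.2.2 q.2 := by
  unfold ph
  fun_prop

lemma modu_meas (lam : ℝ) {m n : ℕ} : Measurable (Function.uncurry (modu lam (m := m) (n := n))) := by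
  unfold Function.uncurry modu
  fun_prop

lemma chr_meas (lam : ℝ) {m n : ℕ} : Measurable (Function.uncurry (chr lam (m := m) (n := n))) := by
  unfold Function.uncurry chr
  fun_prop

lemma vol_box (lam : ℝ) (n : ℕ) : (volume : Measure (Fin n → ℝ)).restrict (torusBox lam n)
    = Measure.pi fun _ : Fin n => volume.restrict (Set.Icc 0 (2 * Real.pi * lam)) := by
  rw [← Measure.restrict_pi_pi]
  unfold torusBox
  rw [← Set.pi_univ_Icc]
  rfl

lemma PL_wave (lam : ℝ) (hl : 0 < lam) (m n : ℕ) :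
    PL ((volume : Measure (Fin m → ℝ)).prod ((volume : Measure (Fin n → ℝ)).restrict (torusBox lam n)))
      ((volume : Measure (Fin m → ℝ)).prod (Measure.count : Measure (Fin n → ℤ)))
      (chr lam) (ENNReal.ofReal (2 * Real.pi) ^ m * ENNReal.ofReal (2 * Real.pi * lam) ^ n) := by
  rw [vol_box, ← pi_count]
  have hA : PL (volume : Measure (Fin m → ℝ)) (volume : Measure (Fin m → ℝ))
      (fun x k => ∏ i, Complex.exp (Complex.I * ((x i * k i : ℝ) : ℂ))) (ENNReal.ofReal (2 * Real.pi) ^ m) :=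
    PL_pi (by unfold Function.uncurry; fun_prop) (fun x k => Complex.norm_exp_I_mul_ofReal _) PL_real m
  have hB := PL_pi (e := fun (x : ℝ) (k : ℤ) => Complex.exp (Complex.I * ((x * (k / lam) : ℝ) : ℂ)))
    (by unfold Function.uncurry; fun_prop) (fun x k => Complex.norm_exp_I_mul_ofReal _) (PL_torus lam hl) n
  have hP := PL_prod (by unfold Function.uncurry; fun_prop) (by unfold Function.uncurry; fun_prop)
    (by intro x k; simp [Complex.norm_exp_I_mul_ofReal, -Complex.ofReal_mul])
    (by intro x k; simp [Complex.norm_exp_I_mul_ofReal, -Complex.ofReal_mul, -Complex.ofReal_div]) hA hB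
  exact hP

/-- first two coordinates split off -/
def split2 (m : ℕ) : (Fin (m + 2) → ℝ) ≃ᵐ R2 × (Fin m → ℝ) :=
  ((MeasurableEquiv.piFinSuccAbove (fun _ : Fin (m + 2) => ℝ) 0).trans
    ((MeasurableEquiv.refl ℝ).prodCongr (MeasurableEquiv.piFinSuccAbove (fun _ : Fin (m + 1) => ℝ) 0))).trans
    MeasurableEquiv.prodAssoc.symm

lemma split2_apply (m : ℕ) (x : Fin (m + 2) → ℝ) : split2 m x = ((x 0, x 1), fun i => x i.succ.succ) := rfl

lemma split2_mp (m : ℕ) : MeasurePreserving (split2 m) volume (volume.prod volume) := by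
  have h1 := volume_preserving_piFinSuccAbove (fun _ : Fin (m + 2) => ℝ) 0
  have h2 := volume_preserving_piFinSuccAbove (fun _ : Fin (m + 1) => ℝ) 0
  have h3 := ((MeasurePreserving.id (volume : Measure ℝ)).prod h2)
  have h4 := (measurePreserving_prodAssoc (volume : Measure ℝ) (volume : Measure ℝ) (volume : Measure (Fin m → ℝ))).symm
  exact (h4.comp h3).comp h1

def splitK (m n : ℕ) : (Fin (m + 2) → ℝ) × (Fin n → ℤ) ≃ᵐ R2 × ((Fin m → ℝ) × (Fin n → ℤ)) :=
  ((split2 m).prodCongr (MeasurableEquiv.refl _)).trans MeasurableEquiv.prodAssoc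

lemma splitK_mp (m n : ℕ) : MeasurePreserving (splitK m n) (volume.prod Measure.count) (volume.prod (volume.prod Measure.count)) := by
  have h1 := (split2_mp m).prod (MeasurePreserving.id (Measure.count : Measure (Fin n → ℤ)))
  exact (measurePreserving_prodAssoc _ _ _).comp h1

lemma ph_split (lam : ℝ) {m n : ℕ} (t : ℝ) (x : Fin (m + 2) → ℝ) (y : Fin n → ℝ) (k : (Fin (m + 2) → ℝ) × (Fin n → ℤ)) :
    ph lam t x y k = kern2 (t, (split2 m x).1) (splitK m n k).1 * 
      (modu lam t (splitK m n k).2 * chr lam ((split2 m x).2, y) (splitK m n k).2) := by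
  have : splitK m n k = ((k.1 0, k.1 1), (fun i => k.1 i.succ.succ, k.2)) := rfl
  rw [chr_eq, this, split2_apply]
  unfold ph modu kern2
  simp only [← Complex.exp_add]
  congr 1
  simp only [Fin.sum_univ_succ, Fin.succ_zero_eq_one]
  push_cast
  ring

/-- frequency box -/
def freqBox (lam N : ℝ) (m n : ℕ) : Set ((Fin m → ℝ) × (Fin n → ℤ)) :=
  (Set.univ.pi fun _ => Set.Icc (-(2 * N)) (2 * N)) ×ˢ (Set.univ.pi fun _ => {j : ℤ | |(j : ℝ) / lam| ≤ 2 * N})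

lemma count_bound (lam N : ℝ) (hl : 1 ≤ lam) (hN : 1 ≤ N) : 
    (Measure.count : Measure ℤ) {j : ℤ | |(j : ℝ) / lam| ≤ 2 * N} ≤ ENNReal.ofReal (5 * N * lam) := by
  have hl0 : 0 < lam := by linarith
  have h1 : 1 ≤ N * lam := by nlinarith
  have hsub : {j : ℤ | |(j : ℝ) / lam| ≤ 2 * N} ⊆ ((Finset.Icc (-⌊2 * N * lam⌋) ⌊2 * N * lam⌋ : Finset ℤ) : Set ℤ) := by
    intro j hj
    simp only [Set.mem_ofPred_eq] at hj
    rw [abs_div, abs_of_pos hl0, div_le_iff₀ hl0, abs_le] at hj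
    simp only [Finset.coe_Icc, Set.mem_Icc]
    constructor
    · rw [neg_le, Int.le_floor]; push_cast; linarith
    · rw [Int.le_floor]; linarith
  refine (measure_mono hsub).trans ?_
  rw [Measure.count_apply_finset]
  simp only [Int.card_Icc]
  have hf0 : 0 ≤ ⌊2 * N * lam⌋ := Int.floor_nonneg.2 (by nlinarith)
  have hf := Int.floor_le (2 * N * lam)
  rw [← ENNReal.ofReal_natCast]
  apply ENNReal.ofReal_le_ofReal
  have e : (((⌊2 * N * lam⌋ + 1 - -⌊2 * N * lam⌋).toNat : ℤ) : ℝ) = ((2 * ⌊2 * N * lam⌋ + 1 : ℤ) : ℝ) := by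
    rw [Int.toNat_of_nonneg (by omega)]; congr 1; ring
  rw [Int.cast_natCast] at e
  rw [e]
  push_cast
  linarith

lemma freqBox_meas (lam N : ℝ) (hl : 1 ≤ lam) (hN : 1 ≤ N) (m n : ℕ) :
    ((volume : Measure (Fin m → ℝ)).prod (Measure.count : Measure (Fin n → ℤ))) (freqBox lam N m n)
      ≤ ENNReal.ofReal (4 * N) ^ m * ENNReal.ofReal (5 * N * lam) ^ n := by
  unfold freqBox
  rw [Measure.prod_prod, ← pi_count, volume_pi, Measure.pi_pi, Measure.pi_pi]
  simp only [Finset.prod_const, Finset.card_univ, Fintype.card_fin, Real.volume_Icc]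
  gcongr
  · linarith
  · exact count_bound lam N hl hN

lemma u_meas (lam : ℝ) (m n : ℕ) (f : (Fin m → ℝ) × (Fin n → ℤ) → ℂ) (hf : Measurable f) :
    Measurable fun q : ℝ × (Fin m → ℝ) × (Fin n → ℝ) => ∫ k, f k * ph lam q.1 q.2.1 q.2.2 k ∂(volume.prod Measure.count) := by
  apply measurable_param
  exact (hf.comp measurable_snd).mul (ph_meas lam)

lemma L2_full (lam : ℝ) (hl : 0 < lam) (m n : ℕ) (f : (Fin m → ℝ) × (Fin n → ℤ) → ℂ) (hf : Measurable f) (t : ℝ) :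
    ∫⁻ x : Fin m → ℝ, ∫⁻ y in torusBox lam n, ‖∫ k, f k * ph lam t x y k ∂(volume.prod Measure.count)‖ₑ ^ 2
     ≤ ENNReal.ofReal (2 * Real.pi) ^ m * ENNReal.ofReal (2 * Real.pi * lam) ^ n * ∫⁻ k, ‖f k‖ₑ ^ 2 ∂(volume.prod Measure.count) := by
  have hmt : Measurable (modu lam (m := m) (n := n) t) := (modu_meas lam).comp (measurable_const.prodMk measurable_id)
  have := PL_wave lam hl m n (fun k => f k * modu lam t k) (hf.mul hmt)
  have e : ∀ k, ‖f k * modu lam t k‖ₑ = ‖f k‖ₑ := by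
    intro k; rw [enorm_mul, enorm_unit (modu_norm _ _ _), mul_one]
  simp only [e] at this
  refine le_trans (le_of_eq ?_) this
  rw [lintegral_prod]
  · simp only [ph_eq, mul_assoc]
  · refine Measurable.aemeasurable ?_
    have := ((u_meas lam m n f hf).enorm.pow_const 2).comp (f := fun z : (Fin m → ℝ) × (Fin n → ℝ) => (t, z)) (by fun_prop)
    simp only [ph_eq, mul_assoc, Function.comp_def] at this
    simp only [mul_assoc]
    exact this

lemma L4_full (lam N : ℝ) (hl : 1 ≤ lam) (hN : 1 ≤ N) (m n : ℕ) (f : (Fin (m + 2) → ℝ) × (Fin n → ℤ) → ℂ) (hf : Measurable f) 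
    (hS : ∀ k, f k ≠ 0 → k ∈ freqBox lam N (m + 2) n) :
    ∫⁻ t : ℝ, ∫⁻ x : Fin (m + 2) → ℝ, ∫⁻ y in torusBox lam n, ‖∫ k, f k * ph lam t x y k ∂(volume.prod Measure.count)‖ₑ ^ 4
     ≤ (ENNReal.ofReal (4 * N) ^ m * ENNReal.ofReal (5 * N * lam) ^ n) *
      (ENNReal.ofReal (2 * Real.pi) ^ m * ENNReal.ofReal (2 * Real.pi * lam) ^ n) * 
      (ENNReal.ofReal (2 * Real.pi) ^ 4 * (∫⁻ k, ‖f k‖ₑ ^ 2 ∂(volume.prod Measure.count)) ^ 2) := by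
  have hl0 : 0 < lam := by linarith
  have key := L4_prod (e1 := kern2) (φ := fun (a : ℝ × R2) (k : (Fin m → ℝ) × (Fin n → ℤ)) => modu lam a.1 k)
    (e2 := chr lam) kern2_meas 
    ((modu_meas lam (m := m) (n := n)).comp (f := fun q : (ℝ × R2) × ((Fin m → ℝ) × (Fin n → ℤ)) => (q.1.1, q.2)) (by fun_prop))
    (chr_meas lam) kern2_norm (fun a k => modu_norm _ _ _) (chr_norm lam)
    strichartz2 (PL_wave lam hl0 m n) (freqBox lam N m n) (fun k => f ((splitK m n).symm k))
    (hf.comp (splitK m n).symm.measurable) (by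
      intro k hk
      have h := hS _ hk
      obtain ⟨k, rfl⟩ := (splitK m n).surjective k
      rw [MeasurableEquiv.symm_apply_apply] at h
      have : splitK m n k = ((k.1 0, k.1 1), (fun i => k.1 i.succ.succ, k.2)) := rfl
      rw [this]
      refine ⟨fun i _ => h.1 i.succ.succ (Set.mem_univ _), h.2⟩)
  have keyB := key.trans (mul_le_mul_left (mul_le_mul_left (freqBox_meas lam N hl hN m n) _) _)
  have e1 := (splitK_mp m n).lintegral_comp_emb (splitK m n).measurableEmbedding (fun k => ‖f ((splitK m n).symm k)‖ₑ ^ 2)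
  simp only [MeasurableEquiv.symm_apply_apply] at e1
  rw [e1]
  refine le_trans (le_of_eq ?_) keyB
  set U : ℝ × (Fin (m + 2) → ℝ) × (Fin n → ℝ) → ℝ≥0∞ := fun q => ‖∫ k, f k * ph lam q.1 q.2.1 q.2.2 k ∂(volume.prod Measure.count)‖ₑ ^ 4 with hU
  have hUm : Measurable U := (u_meas lam (m + 2) n f hf).enorm.pow_const 4
  have e2 : ∀ (a : ℝ × R2) (z : (Fin m → ℝ) × (Fin n → ℝ)), 
     ‖∫ k, f ((splitK m n).symm k) * (kern2 a k.1 * (modu lam a.1 k.2 * chr lam z k.2)) ∂(volume.prod (volume.prod Measure.count))‖ₑ ^ 4 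
      = U (a.1, (split2 m).symm (a.2, z.1), z.2) := by
    intro a z
    simp only [hU]
    rw [← (splitK_mp m n).integral_comp (splitK m n).measurableEmbedding]
    simp only [MeasurableEquiv.symm_apply_apply, ph_split, MeasurableEquiv.apply_symm_apply]
  simp_rw [e2]
  have m1 : Measurable fun q : (ℝ × R2) × ((Fin m → ℝ) × (Fin n → ℝ)) => U (q.1.1, (split2 m).symm (q.1.2, q.2.1), q.2.2) := by
    apply hUm.comp
    refine Measurable.prodMk (by fun_prop) (Measurable.prodMk ?_ (by fun_prop))
    exact (split2 m).symm.measurable.comp (by fun_prop)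
  have m2 : Measurable fun a : ℝ × R2 => ∫⁻ z, U (a.1, (split2 m).symm (a.2, z.1), z.2) 
      ∂((volume : Measure (Fin m → ℝ)).prod ((volume : Measure (Fin n → ℝ)).restrict (torusBox lam n))) :=
    m1.lintegral_prod_right'
  have e3 := lintegral_prod (μ := (volume : Measure ℝ)) (ν := (volume : Measure R2)) _ m2.aemeasurable
  refine Eq.trans ?_ e3.symm
  refine lintegral_congr fun t => ?_
  have m3 : Measurable fun x : Fin (m + 2) → ℝ => ∫⁻ y in torusBox lam n, U (t, x, y) := by
    have : Measurable fun q : (Fin (m + 2) → ℝ) × (Fin n → ℝ) => U (t, q.1, q.2) := hUm.comp (by fun_prop)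
    exact this.lintegral_prod_right'
  have e4 := (split2_mp m).symm.lintegral_comp_emb (split2 m).symm.measurableEmbedding (fun x => ∫⁻ y in torusBox lam n, U (t, x, y))
  change ∫⁻ x, ∫⁻ y in torusBox lam n, U (t, x, y) = _
  rw [← e4]
  have e5 := lintegral_prod (μ := (volume : Measure R2)) (ν := (volume : Measure (Fin m → ℝ)))
    (fun a => ∫⁻ y in torusBox lam n, U (t, (split2 m).symm a, y)) (m3.comp (split2 m).symm.measurable).aemeasurable
  refine e5.trans ?_
  refine lintegral_congr fun x' => ?_
  have m5 : Measurable fun z : (Fin m → ℝ) × (Fin n → ℝ) => U (t, (split2 m).symm (x', z.1), z.2) := 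
    m1.comp (f := fun z : (Fin m → ℝ) × (Fin n → ℝ) => ((t, x'), z)) (by fun_prop)
  exact (lintegral_prod _ m5.aemeasurable).symm


lemma freqBox_measurable (lam N : ℝ) (m n : ℕ) : MeasurableSet (freqBox lam N m n) := by
  unfold freqBox
  refine MeasurableSet.prod (MeasurableSet.univ_pi fun _ => measurableSet_Icc) (MeasurableSet.univ_pi fun _ => ?_)
  exact DiscreteMeasurableSpace.forall_measurableSet _

lemma ph_meas_slice (lam : ℝ) {m n : ℕ} (t : ℝ) (x : Fin m → ℝ) (y : Fin n → ℝ) (j : Fin n → ℤ) :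
    Measurable fun ζ => ph lam t x y (ζ, j) :=
  (ph_meas lam).comp (f := fun ζ : Fin m → ℝ => ((t, x, y), (ζ, j))) (by fun_prop)

lemma supp_box_s7 {lam N : ℝ} {m n : ℕ} (hN : 0 ≤ N) {g : (Fin m → ℝ) → (Fin n → ℤ) → ℂ} (h : SuppIn lam g N)
    (ζ j) (hz : g ζ j ≠ 0) : (ζ, j) ∈ freqBox lam N m n := by
  have h1 := (h ζ j hz).1
  unfold freqNorm at h1
  rw [Real.sqrt_le_left (by linarith)] at h1
  have s1 : 0 ≤ ∑ i, (ζ i) ^ 2 := Finset.sum_nonneg fun i _ => sq_nonneg _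
  have s2 : 0 ≤ ∑ i, ((j i : ℝ) / lam) ^ 2 := Finset.sum_nonneg fun i _ => sq_nonneg _
  refine ⟨fun i _ => ?_, fun i _ => ?_⟩
  · have : (ζ i) ^ 2 ≤ ∑ i, (ζ i) ^ 2 := Finset.single_le_sum (f := fun i => (ζ i) ^ 2) (fun i _ => sq_nonneg _) (Finset.mem_univ i)
    exact abs_le.1 (abs_le_of_sq_le_sq (by linarith) (by linarith))
  · have : ((j i : ℝ) / lam) ^ 2 ≤ ∑ i, ((j i : ℝ) / lam) ^ 2 :=
      Finset.single_le_sum (f := fun i => ((j i : ℝ) / lam) ^ 2) (fun i _ => sq_nonneg _) (Finset.mem_univ i)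
    have h2 : ((j i : ℝ) / lam) ^ 2 ≤ (2 * N) ^ 2 := by linarith
    have h3 : |(j i : ℝ) / lam| ≤ 2 * N := abs_le_of_sq_le_sq h2 (by linarith)
    exact h3

lemma reduce {lam N : ℝ} {m n : ℕ} (hN : 0 ≤ N) {g : (Fin m → ℝ) → (Fin n → ℤ) → ℂ} (h : SuppIn lam g N) :
    ∃ f : (Fin m → ℝ) × (Fin n → ℤ) → ℂ, Measurable f ∧ (∀ k, f k ≠ 0 → k ∈ freqBox lam N m n) ∧
      (∀ t x y j, ∫ ζ, g ζ j * ph lam t x y (ζ, j) = ∫ ζ, f (ζ, j) * ph lam t x y (ζ, j)) ∧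
      ∫⁻ k, ‖f k‖ₑ ^ 2 ∂(volume.prod Measure.count) ≤ ∑' j, ∫⁻ ζ, (‖g ζ j‖₊ : ℝ≥0∞) ^ 2 := by
  have hs : ∀ j : Fin n → ℤ, MeasurableSet {ζ : Fin m → ℝ | (ζ, j) ∈ freqBox lam N m n} := fun j =>
    (freqBox_measurable lam N m n).preimage (f := fun ζ : Fin m → ℝ => (ζ, j)) (by fun_prop)
  have key : ∀ j : Fin n → ℤ, ∃ F : (Fin m → ℝ) → ℂ, Measurable F ∧ (∀ ζ, F ζ ≠ 0 → (ζ, j) ∈ freqBox lam N m n) ∧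
      (∀ t x y, ∫ ζ, g ζ j * ph lam t x y (ζ, j) = ∫ ζ, F ζ * ph lam t x y (ζ, j)) ∧
      ∫⁻ ζ, ‖F ζ‖ₑ ^ 2 ≤ ∫⁻ ζ, (‖g ζ j‖₊ : ℝ≥0∞) ^ 2 := by
    intro j
    by_cases hm : AEStronglyMeasurable (fun ζ => g ζ j) volume
    · set F := Set.indicator {ζ : Fin m → ℝ | (ζ, j) ∈ freqBox lam N m n} (hm.mk _) with hF
      have hae : (fun ζ => g ζ j) =ᵐ[volume] F := by
        filter_upwards [hm.ae_eq_mk] with ζ hζ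
        by_cases hz : (ζ, j) ∈ freqBox lam N m n
        · rw [hF, Set.indicator_of_mem (by exact hz)]; exact hζ
        · rw [hF, Set.indicator_of_notMem (by exact hz)]
          by_contra h0
          exact hz (supp_box_s7 hN h ζ j h0)
      refine ⟨F, hm.stronglyMeasurable_mk.measurable.indicator (hs j), ?_, ?_, ?_⟩
      · intro ζ hz
        have h3 : ζ ∈ {ζ : Fin m → ℝ | (ζ, j) ∈ freqBox lam N m n} := Set.mem_of_indicator_ne_zero hz
        exact h3
      · intro t x y
        apply integral_congr_ae
        filter_upwards [hae] with ζ hζ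
        simp only [← hζ]
      · apply le_of_eq
        apply lintegral_congr_ae
        filter_upwards [hae] with ζ hζ
        simp only [← hζ]
        rfl
    · refine ⟨0, measurable_zero, by simp, ?_, by simp⟩
      intro t x y
      rw [integral_undef]
      · simp
      · rw [integrable_mul_unit (ph_meas_slice lam t x y j) (fun _ => ph_norm _ _ _ _ _)]
        exact fun hi => hm hi.1
  choose F hFm hFs hFi hFl using key
  have hmeas : Measurable fun k : (Fin m → ℝ) × (Fin n → ℤ) => F k.2 k.1 :=
    measurable_from_prod_countable_left hFm
  refine ⟨fun k => F k.2 k.1, hmeas, fun k hk => hFs _ _ hk, fun t x y j => hFi j t x y, ?_⟩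
  rw [lintegral_prod_symm _ (hmeas.enorm.pow_const 2).aemeasurable, lintegral_count]
  exact ENNReal.tsum_le_tsum hFl

lemma wave_eq {lam N : ℝ} (hl : 1 ≤ lam) (hN : 1 ≤ N) {m n : ℕ} {g : (Fin m → ℝ) → (Fin n → ℤ) → ℂ}
    {f : (Fin m → ℝ) × (Fin n → ℤ) → ℂ} (hf : Measurable f) (hS : ∀ k, f k ≠ 0 → k ∈ freqBox lam N m n)
    (hg : ∀ t x y j, ∫ ζ, g ζ j * ph lam t x y (ζ, j) = ∫ ζ, f (ζ, j) * ph lam t x y (ζ, j))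
    (hfin : ∫⁻ k, ‖f k‖ₑ ^ 2 ∂(volume.prod Measure.count) ≠ ⊤) (t x y) :
    waveU lam g t x y = ((1 / lam ^ n : ℝ) : ℂ) * ∫ k, f k * ph lam t x y k ∂(volume.prod Measure.count) := by
  have hInt : Integrable f (volume.prod Measure.count) := by
    rw [← integrableOn_iff_integrable_of_support_subset (s := freqBox lam N m n) (fun k hk => hS k hk)]
    have : IsFiniteMeasure (((volume : Measure (Fin m → ℝ)).prod (Measure.count : Measure (Fin n → ℤ))).restrict (freqBox lam N m n)) := by
      constructor
      rw [Measure.restrict_apply_univ]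
      refine (freqBox_meas lam N hl hN m n).trans_lt ?_
      exact ENNReal.mul_lt_top (ENNReal.pow_lt_top ENNReal.ofReal_lt_top) (ENNReal.pow_lt_top ENNReal.ofReal_lt_top)
    have h2 : MemLp f 2 ((volume : Measure (Fin m → ℝ)).prod (Measure.count : Measure (Fin n → ℤ))) := by
      refine ⟨hf.aestronglyMeasurable, ?_⟩
      rw [eLpNorm_lt_top_iff_lintegral_rpow_enorm_lt_top (by simp) (by simp)]
      simpa using hfin.lt_top
    exact (h2.restrict _).integrable (by norm_num)
  have hInt2 : Integrable (fun k => f k * ph lam t x y k) (volume.prod Measure.count) := by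
    rw [integrable_mul_unit _ (fun _ => ph_norm _ _ _ _ _)]
    · exact hInt
    · exact (ph_meas lam).comp (f := fun k => ((t, x, y), k)) (by fun_prop)
  rw [integral_prod_symm _ hInt2, integral_countable hInt2.integral_prod_right]
  unfold waveU
  congr 1
  apply tsum_congr
  intro j
  have := hg t x y j
  simp only [Measure.real, Measure.count_singleton, ENNReal.toReal_one, one_smul]
  exact this

/-- interpolation between L² and L⁴ -/
lemma interp_s7 {Z : Type*} [MeasurableSpace Z] {μ : Measure Z} {h : Z → ℝ≥0∞} (hh : AEMeasurable h μ) {q θ : ℝ}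
    (h0 : 0 ≤ θ) (h1 : θ ≤ 1) (hq : q = 2 + 2 * θ) :
    ∫⁻ z, h z ^ q ∂μ ≤ (∫⁻ z, h z ^ 2 ∂μ) ^ (1 - θ) * (∫⁻ z, h z ^ 4 ∂μ) ^ θ := by
  have := ENNReal.lintegral_mul_norm_pow_le (hh.pow_const 2) (hh.pow_const 4) (p := 1 - θ) (q := θ) (by linarith) h0 (by ring)
  refine le_trans (le_of_eq ?_) this
  apply lintegral_congr
  intro z
  rw [← ENNReal.rpow_natCast, ← ENNReal.rpow_natCast, ← ENNReal.rpow_mul, ← ENNReal.rpow_mul, ← ENNReal.rpow_add_of_nonneg]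
  · congr 1; rw [hq]; push_cast; ring
  · push_cast; nlinarith
  · push_cast; nlinarith


/-- the two basic estimates -/
lemma basic (m n : ℕ) : ∃ K1 K2 : ℝ, 0 < K1 ∧ 0 < K2 ∧
    ∀ (lam N : ℝ) (g : (Fin (m + 2) → ℝ) → (Fin n → ℤ) → ℂ), 1 ≤ lam → 1 ≤ N → SuppIn lam g N → l2sq lam g ≠ ⊤ →
      (Measurable fun z : ℝ × (Fin (m + 2) → ℝ) × (Fin n → ℝ) => waveU lam g z.1 z.2.1 z.2.2) ∧
      (∀ t, ∫⁻ x : Fin (m + 2) → ℝ, ∫⁻ y in torusBox lam n, ‖waveU lam g t x y‖ₑ ^ 2 ≤ ENNReal.ofReal K1 * l2sq lam g) ∧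
      (∫⁻ t : ℝ, ∫⁻ x : Fin (m + 2) → ℝ, ∫⁻ y in torusBox lam n, ‖waveU lam g t x y‖ₑ ^ 4
        ≤ ENNReal.ofReal (K2 * N ^ (m + n)) * l2sq lam g ^ 2) := by
  have hw0 : 0 < 2 * Real.pi := by positivity
  have HL2 := fun lam hl => L2_full lam hl (m + 2) n
  have HL4 := fun lam N hl hN => L4_full lam N hl hN m n
  generalize 2 * Real.pi = w at *
  refine ⟨w ^ (m + 2) * w ^ n, 4 ^ m * 5 ^ n * (w ^ m * w ^ n) * w ^ 4,
    by positivity, by positivity, ?_⟩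
  intro lam N g hl hN hS hfin
  have hl0 : 0 < lam := by linarith
  obtain ⟨f, hf, hfS, hfg, hfl⟩ := reduce (by linarith) hS
  set X := ∫⁻ k, ‖f k‖ₑ ^ 2 ∂((volume : Measure (Fin (m + 2) → ℝ)).prod (Measure.count : Measure (Fin n → ℤ))) with hX
  set a : ℝ≥0∞ := ENNReal.ofReal (1 / lam ^ n) with ha
  have ha0 : a ≠ 0 := by rw [ha]; simp; positivity
  have hat : a ≠ ⊤ := ENNReal.ofReal_ne_top
  have hal : a * ENNReal.ofReal lam ^ n = 1 := by
    rw [ha, ← ENNReal.ofReal_pow hl0.le, ← ENNReal.ofReal_mul (by positivity)]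
    rw [one_div, inv_mul_cancel₀ (by positivity)]; simp
  have haX : a * X ≤ l2sq lam g := by
    unfold l2sq
    gcongr
  have hXfin : X ≠ ⊤ := by
    intro h
    rw [h, ENNReal.mul_top ha0] at haX
    exact hfin (top_le_iff.1 haX)
  have hw := wave_eq hl hN hf hfS hfg hXfin
  have hen : ∀ t x y, ‖waveU lam g t x y‖ₑ = a * ‖∫ k, f k * ph lam t x y k ∂(volume.prod Measure.count)‖ₑ := by
    intro t x y
    rw [hw, enorm_mul]
    congr 1
    rw [← ofReal_norm, Complex.norm_real, Real.norm_of_nonneg (by positivity)]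
  refine ⟨?_, ?_, ?_⟩
  · simp only [hw]
    exact (u_meas lam (m + 2) n f hf).const_mul _
  · intro t
    simp only [hen, mul_pow]
    have h2 := HL2 lam hl0 f hf t
    simp only [lintegral_const_mul' _ _ (ENNReal.pow_ne_top hat)]
    calc _ ≤ a ^ 2 * (ENNReal.ofReal w ^ (m + 2) * ENNReal.ofReal (w * lam) ^ n * X) := by gcongr
      _ = (ENNReal.ofReal w ^ (m + 2) * ENNReal.ofReal w ^ n) * ((a * ENNReal.ofReal lam ^ n) * (a * X)) := by
          rw [ENNReal.ofReal_mul (p := w) (by positivity), mul_pow]; ring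
      _ ≤ _ := by
          rw [hal, one_mul, ENNReal.ofReal_mul (by positivity), ENNReal.ofReal_pow (by positivity), ENNReal.ofReal_pow (by positivity)]
          gcongr
  · simp only [hen, mul_pow]
    have h4 := HL4 lam N hl hN f hf hfS
    simp only [lintegral_const_mul' _ _ (ENNReal.pow_ne_top hat)]
    calc _ ≤ a ^ 4 * ((ENNReal.ofReal (4 * N) ^ m * ENNReal.ofReal (5 * N * lam) ^ n) *
      (ENNReal.ofReal w ^ m * ENNReal.ofReal (w * lam) ^ n) * 
      (ENNReal.ofReal w ^ 4 * X ^ 2)) := by gcongr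
      _ = (ENNReal.ofReal 4 ^ m * ENNReal.ofReal 5 ^ n * (ENNReal.ofReal w ^ m * ENNReal.ofReal w ^ n) * ENNReal.ofReal w ^ 4 * ENNReal.ofReal N ^ (m + n)) * ((a * ENNReal.ofReal lam ^ n) ^ 2 * (a * X) ^ 2) := by
          rw [ENNReal.ofReal_mul (p := w) (by positivity), ENNReal.ofReal_mul (p := 5 * N) (by positivity), 
            ENNReal.ofReal_mul (p := 5) (by positivity), ENNReal.ofReal_mul (p := 4) (by positivity)]
          simp only [mul_pow]
          ring
      _ ≤ _ := by
          rw [hal, one_pow, one_mul]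
          simp only [← ENNReal.ofReal_pow (show (0:ℝ) ≤ w by positivity), ← ENNReal.ofReal_pow (show (0:ℝ) ≤ N by positivity), ← ENNReal.ofReal_pow (show (0:ℝ) ≤ 4 by positivity), ← ENNReal.ofReal_pow (show (0:ℝ) ≤ 5 by positivity)]
          rw [← ENNReal.ofReal_mul (by positivity), ← ENNReal.ofReal_mul (by positivity), ← ENNReal.ofReal_mul (by positivity), ← ENNReal.ofReal_mul (by positivity), ← ENNReal.ofReal_mul (by positivity)]
          gcongr

lemma spatial_interp {lam : ℝ} {m n : ℕ} {u : (Fin m → ℝ) → (Fin n → ℝ) → ℂ} (hu : Measurable fun z : (Fin m → ℝ) × (Fin n → ℝ) => u z.1 z.2)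
    {q θ : ℝ} (h0 : 0 ≤ θ) (h1 : θ ≤ 1) (hq : q = 2 + 2 * θ) :
    ∫⁻ x : Fin m → ℝ, ∫⁻ y in torusBox lam n, (‖u x y‖₊ : ℝ≥0∞) ^ q ≤
      (∫⁻ x : Fin m → ℝ, ∫⁻ y in torusBox lam n, ‖u x y‖ₑ ^ 2) ^ (1 - θ) * 
      (∫⁻ x : Fin m → ℝ, ∫⁻ y in torusBox lam n, ‖u x y‖ₑ ^ 4) ^ θ := by
  have := interp_s7 (μ := (volume : Measure (Fin m → ℝ)).prod ((volume : Measure (Fin n → ℝ)).restrict (torusBox lam n)))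
    hu.enorm.aemeasurable h0 h1 hq
  rw [lintegral_prod _ (hu.enorm.pow_const q).aemeasurable, lintegral_prod _ (hu.enorm.pow_const 2).aemeasurable,
    lintegral_prod _ (hu.enorm.pow_const 4).aemeasurable] at this
  exact this

/-- **Global-in-time mixed-norm Strichartz estimate on `ℝ^m × 𝕋ⁿ_λ`, `m ≥ 2`,
`p ∈ [4,∞]`, `1/p + 1/q = 1/2`.** (When `p = ∞`, `1/p.toReal = 0` in Lean's convention,
so the hypothesis forces `q = 2`, as it should.) -/
theorem global_strichartz_mixed (m n : ℕ) (hm : 2 ≤ m) (hn : 1 ≤ n)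
    (p : ℝ≥0∞) (hp : 4 ≤ p) (q : ℝ) (hq : 1 / p.toReal + 1 / q = 1 / 2) :
    ∃ C : ℝ, 0 < C ∧
    ∀ (lam N : ℝ) (g : (Fin m → ℝ) → (Fin n → ℤ) → ℂ),
      1 ≤ lam → IsDyadic N → SuppIn lam g N →
      mixedLpLq lam p q (fun t x y => waveU lam g t x y)
        ≤ ENNReal.ofReal (C * N ^ ((((m : ℝ) + n) - 2) / p.toReal))
          * (l2sq lam g) ^ (1 / 2 : ℝ) := by
  obtain ⟨m, rfl⟩ := Nat.exists_eq_add_of_le' hm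
  obtain ⟨K1, K2, hK1, hK2, H⟩ := basic m n
  by_cases hpt : p = ⊤
  · subst hpt
    simp only [ENNReal.toReal_top, div_zero, zero_add, Real.rpow_zero, mul_one] at hq ⊢
    have hq2 : q = 2 := by
      have : q ≠ 0 := by rintro rfl; norm_num at hq
      field_simp at hq; linarith
    subst hq2
    refine ⟨K1 ^ (1 / 2 : ℝ), by positivity, ?_⟩
    intro lam N g hl hN hS
    have hN1 : 1 ≤ N := by obtain ⟨a, rfl⟩ := hN; exact one_le_pow₀ (by norm_num)
    by_cases hfin : l2sq lam g = ⊤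
    · rw [hfin, ENNReal.top_rpow_of_pos (by norm_num), ENNReal.mul_top]
      · exact le_top
      · simp; positivity
    obtain ⟨-, h2, -⟩ := H lam N g hl hN1 hS hfin
    unfold mixedLpLq
    rw [if_pos rfl]
    refine essSup_le_of_ae_le _ (Filter.Eventually.of_forall fun t => ?_)
    unfold spatialLq
    rw [← ENNReal.ofReal_rpow_of_pos hK1, ← ENNReal.mul_rpow_of_nonneg _ _ (by norm_num)]
    refine ENNReal.rpow_le_rpow ?_ (by norm_num)
    refine le_trans (le_of_eq ?_) (h2 t)
    simp only [ENNReal.rpow_ofNat]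
    rfl
  · set P := p.toReal with hP
    have hP4 : 4 ≤ P := by
      have := ENNReal.toReal_mono hpt hp
      simpa using this
    have hP0 : P ≠ 0 := by linarith
    have hq0 : q ≠ 0 := by
      rintro rfl
      simp at hq
      rw [hq] at hP4; norm_num at hP4
    have hP2 : P - 2 ≠ 0 := by linarith
    have hqP : q = 2 * P / (P - 2) := by
      field_simp at hq ⊢; linarith
    set θ := 2 / (P - 2) with hθ
    have hθ0 : 0 ≤ θ := div_nonneg (by norm_num) (by linarith)
    have hθ1 : θ ≤ 1 := by rw [hθ, div_le_one (by linarith)]; linarith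
    have hqθ : q = 2 + 2 * θ := by rw [hqP, hθ]; field_simp; ring
    have hPq : 1 / q * P = (P - 2) / 2 := by rw [hqP]; field_simp
    refine ⟨K1 ^ ((P - 4) / 2 / P) * K2 ^ (1 / P), by positivity, ?_⟩
    intro lam N g hl hN hS
    have hN1 : 1 ≤ N := by obtain ⟨a, rfl⟩ := hN; exact one_le_pow₀ (by norm_num)
    have hN0 : 0 < N := by linarith
    by_cases hfin : l2sq lam g = ⊤
    · rw [hfin, ENNReal.top_rpow_of_pos (by norm_num), ENNReal.mul_top]
      · exact le_top
      · simp; positivity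
    obtain ⟨hm, h2, h4⟩ := H lam N g hl hN1 hS hfin
    unfold mixedLpLq
    rw [if_neg hpt]
    set S := l2sq lam g with hSdef
    have hpt1 : ∀ t, spatialLq lam q (waveU lam g t) ^ P ≤ (ENNReal.ofReal K1 * S) ^ ((P - 4) / 2) *
        ∫⁻ x : Fin (m + 2) → ℝ, ∫⁻ y in torusBox lam n, ‖waveU lam g t x y‖ₑ ^ 4 := by
      intro t
      unfold spatialLq
      rw [← ENNReal.rpow_mul, hPq]
      have hmt : Measurable fun z : (Fin (m + 2) → ℝ) × (Fin n → ℝ) => waveU lam g t z.1 z.2 :=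
        hm.comp (f := fun z : (Fin (m + 2) → ℝ) × (Fin n → ℝ) => (t, z)) (by fun_prop)
      refine (ENNReal.rpow_le_rpow (spatial_interp hmt hθ0 hθ1 hqθ) (by linarith)).trans ?_
      rw [ENNReal.mul_rpow_of_nonneg _ _ (by linarith), ← ENNReal.rpow_mul, ← ENNReal.rpow_mul]
      have e1 : θ * ((P - 2) / 2) = 1 := by rw [hθ]; field_simp
      have e2 : (1 - θ) * ((P - 2) / 2) = (P - 4) / 2 := by rw [sub_mul, e1]; ring
      rw [e1, e2, ENNReal.rpow_one]
      gcongr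
      exact h2 t
    have hPpos : 0 < P := by linarith
    have hA : (ENNReal.ofReal K1 * S) ^ ((P - 4) / 2) ≠ ⊤ :=
      ENNReal.rpow_ne_top_of_nonneg (by linarith) (ENNReal.mul_ne_top ENNReal.ofReal_ne_top hfin)
    have hI : ∫⁻ t, spatialLq lam q (waveU lam g t) ^ P ≤ (ENNReal.ofReal K1 * S) ^ ((P - 4) / 2) *
        (ENNReal.ofReal (K2 * N ^ (m + n)) * S ^ 2) := by
      refine (lintegral_mono hpt1).trans ?_
      rw [lintegral_const_mul' _ _ hA]
      gcongr
    refine (ENNReal.rpow_le_rpow hI (by positivity)).trans (le_of_eq ?_)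
    have hP40 : 0 ≤ (P - 4) / 2 := by linarith
    have hPi : 0 ≤ 1 / P := by positivity
    rw [ENNReal.mul_rpow_of_nonneg _ _ hP40, ENNReal.mul_rpow_of_nonneg _ _ hPi, ENNReal.mul_rpow_of_nonneg _ _ hPi,
      ENNReal.mul_rpow_of_nonneg _ _ hPi, ← ENNReal.rpow_mul, ← ENNReal.rpow_mul, ← ENNReal.rpow_natCast S 2, ← ENNReal.rpow_mul,
      ENNReal.ofReal_rpow_of_pos hK1, ENNReal.ofReal_rpow_of_pos (by positivity)]
    have e3 : (1 / 2 : ℝ) = (P - 4) / 2 * (1 / P) + ((2 : ℕ) : ℝ) * (1 / P) := by push_cast; field_simp; ring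
    rw [e3, ENNReal.rpow_add_of_nonneg _ _ (by positivity) (by positivity)]
    have e4 : K1 ^ ((P - 4) / 2 / P) * K2 ^ (1 / P) * N ^ ((((m + 2 : ℕ) : ℝ) + n - 2) / P)
        = K1 ^ ((P - 4) / 2 * (1 / P)) * (K2 * N ^ (m + n)) ^ (1 / P) := by
      rw [Real.mul_rpow hK2.le (by positivity), ← Real.rpow_natCast N, ← Real.rpow_mul hN0.le, mul_assoc, mul_one_div]
      congr 3
      push_cast; field_simp; ring
    rw [e4, ENNReal.ofReal_mul (by positivity)]
    ring
end
end
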